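/- arXiv:2509.14135 — 6 statements merged into one kernel-verified Lean document; each statement's English description precedes it below -/
import Mathlib

section
/- Let G be a connected (P2∪P4, bull, diamond)-free simple graph. Then at least one of the following holds: (i) G has a comparable pair, i.e., two nonadjacent vertices u, v with N(u) ⊆ N(v); (ii) the minimum degree of G satisfies δ(G) ≤ ω(G) − 1; (iii) G is isomorphic to the Cartesian product K2□K_{ω(G)}; (iv) G contains the Grötzsch graph F1 as an induced subgraph, G is isomorphic to an induced subgraph of the Clebsch graph F2, and χ(G) = 4; (v) χ(G) ≤ 3. -/
open SimpleGraph

/-- `H` is (isomorphic to) an induced subgraph of `G`. -/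
def ContainsInduced {α β : Type*} (H : SimpleGraph α) (G : SimpleGraph β) : Prop :=
  ∃ f : α ↪ β, ∀ a b : α, G.Adj (f a) (f b) ↔ H.Adj a b

/-- The disjoint union `P2 ∪ P4`. -/
def P2UnionP4 : SimpleGraph (Fin 6) :=
  SimpleGraph.fromEdgeSet {s(0,1), s(2,3), s(3,4), s(4,5)}

/-- The bull: a triangle with two disjoint pendant edges. -/
def BullGraph : SimpleGraph (Fin 5) :=
  SimpleGraph.fromEdgeSet {s(0,1), s(0,2), s(1,2), s(0,3), s(1,4)}

/-- The triangle `C3`. -/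
def TriangleGraph : SimpleGraph (Fin 3) := ⊤

/-- The paw: a triangle with a pendant edge. -/
def PawGraph : SimpleGraph (Fin 4) :=
  SimpleGraph.fromEdgeSet {s(0,1), s(0,2), s(1,2), s(0,3)}

/-- The diamond: `K4` minus an edge. -/
def DiamondGraph : SimpleGraph (Fin 4) :=
  SimpleGraph.fromEdgeSet {s(0,1), s(0,2), s(0,3), s(1,2), s(1,3)}

/-- The 5-cycle. -/
def Cycle5 : SimpleGraph (Fin 5) :=
  SimpleGraph.fromEdgeSet {s(0,1), s(1,2), s(2,3), s(3,4), s(0,4)}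

/-- The 7-cycle. -/
def Cycle7 : SimpleGraph (Fin 7) :=
  SimpleGraph.fromEdgeSet {s(0,1), s(1,2), s(2,3), s(3,4), s(4,5), s(5,6), s(0,6)}

/-- The Grötzsch graph `F1`: vertex `0` is `v`, vertices `1,…,5` are `w1,…,w5`,
vertices `6,…,10` are `v1,…,v5`; `v` is adjacent exactly to the `wᵢ`, the `vᵢ` form a
5-cycle, and `wᵢ` is adjacent exactly to `v`, `vᵢ` and `vᵢ₊₂` (indices mod 5). -/
def GrotzschGraph : SimpleGraph (Fin 11) :=
  SimpleGraph.fromEdgeSet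
    {s(0,1), s(0,2), s(0,3), s(0,4), s(0,5),
     s(6,7), s(7,8), s(8,9), s(9,10), s(6,10),
     s(1,6), s(1,8), s(2,7), s(2,9), s(3,8), s(3,10), s(4,9), s(4,6), s(5,10), s(5,7)}

/-- The Clebsch graph `F2`: vertices are the elements of `(ℤ/2)⁴`, two vertices adjacent
iff their difference is one of `e1, e2, e3, e4, e1+e2+e3+e4`. -/
def ClebschGraph : SimpleGraph (Fin 4 → ZMod 2) :=
  SimpleGraph.fromRel (fun x y =>
    x - y ∈ ({Pi.single 0 1, Pi.single 1 1, Pi.single 2 1, Pi.single 3 1, 1} :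
      Set (Fin 4 → ZMod 2)))

/-- A graph is perfect if every induced subgraph has chromatic number equal to clique number. -/
def SimpleGraph.IsPerfect {V : Type*} (G : SimpleGraph V) : Prop :=
  ∀ S : Set V, (G.induce S).chromaticNumber = ((G.induce S).cliqueNum : ℕ∞)

/-- A graph is perfectly divisible if each nonempty induced subgraph `H` has a partition
`(A, B)` of its vertex set such that `H[A]` is perfect and `ω(H[B]) < ω(H)`. -/
def SimpleGraph.PerfectlyDivisible {V : Type*} (G : SimpleGraph V) : Prop :=
  ∀ S : Set V, S.Nonempty → ∃ A B : Set V, A ∪ B = S ∧ A ∩ B = ∅ ∧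
    (G.induce A).IsPerfect ∧ (G.induce B).cliqueNum < (G.induce S).cliqueNum

namespace GraphSearch

/-- `k x`, arranged so that kernel reduction evaluates `x` to a numeral first. -/
def force {α : Type} (x : ℕ) (k : ℕ → α) : α :=
  Nat.rec (motive := fun _ => α) (k 0) (fun m _ => k (Nat.succ m)) x

/-- A conditional whose branches the kernel evaluates lazily. -/
def select {α : Type} (b : Bool) (x y : α) : α :=
  Bool.rec (motive := fun _ => α) y x b

def anyBitAux (p : ℕ → Bool) (k : ℕ) : ℕ → Bool :=
  Nat.rec (motive := fun _ => ℕ → Bool) (fun _ => false)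
    (fun _ ih m => Nat.rec (motive := fun _ => Bool) false (fun m' _ =>
      force (Nat.log2 (Nat.succ m')) fun i =>
        select (p i) true (ih (Nat.xor (Nat.succ m') (Nat.shiftLeft 1 i)))) m) k

/-- Whether `p i` holds for some bit `i` of `m`. -/
def anyBit (m : ℕ) (p : ℕ → Bool) : Bool := anyBitAux p 32 m

def findBitAux {α : Type} (p : ℕ → Option α) (k : ℕ) : ℕ → Option α :=
  Nat.rec (motive := fun _ => ℕ → Option α) (fun _ => none)
    (fun _ ih m => Nat.rec (motive := fun _ => Option α) none (fun m' _ =>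
      force (Nat.log2 (Nat.succ m')) fun i =>
        Option.rec (motive := fun _ => Option α)
          (ih (Nat.xor (Nat.succ m') (Nat.shiftLeft 1 i))) some (p i)) m) k

/-- The first success of `p` among the bits of `m`. -/
def findBit {α : Type} (m : ℕ) (p : ℕ → Option α) : Option α := findBitAux p 32 m

def mem (m i : ℕ) : Bool := Nat.beq (Nat.land (Nat.shiftRight m i) 1) 1

/-- The neighbourhood of `i` in the graph packed into `H`, 32 bits to a vertex. -/
def row (H i : ℕ) : ℕ := Nat.land (Nat.shiftRight H (Nat.mul 32 i)) 4294967295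

/-- The vertices of `F` outside `a`. -/
def compl (F a : ℕ) : ℕ := Nat.xor F (Nat.land F a)

def p4From (H m t : ℕ) : Bool :=
  force m fun m => force (Nat.land t m) fun t => anyBit t fun c =>
    anyBit (Nat.land (row H c) m) fun d => select (Nat.beq (Nat.land (row H d) m) t) false true

def edgeAny (H m : ℕ) (p : ℕ → Bool) : Bool :=
  force m fun m => anyBit m fun a => force (row H a) fun ra =>
    anyBit (Nat.land (Nat.land ra m) (Nat.sub (Nat.shiftLeft 1 a) 1)) fun b =>
      p (Nat.lor ra (row H b))

def bad (F H w rw t : ℕ) : Bool :=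
  select (select (mem t w)
    (select (Nat.beq (Nat.land rw t) 0)
      (force (compl F (Nat.lor t rw)) fun m => anyBit m fun y => p4From H m (row H y)) true)
    (select (anyBit (compl rw t) fun a => p4From H (compl F (Nat.lor rw (row H a))) t) true
      (anyBit (compl t rw) fun a => p4From H (compl F (Nat.lor t (row H a))) rw))) true
    (edgeAny H (compl F (Nat.lor t rw)) fun r => p4From H (compl F r) t)

def addVertexAux (n H s : ℕ) (k : ℕ) : ℕ :=
  Nat.rec (motive := fun _ => ℕ) 0 (fun i ih =>
    force ih fun ih => force i fun i => Nat.lor ih (Nat.shiftLeft (Nat.lor (row H i)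
      (select (mem s i) (Nat.shiftLeft 1 n) 0)) (Nat.mul 32 i))) k

/-- The graph `H` on `n` vertices with a new vertex of neighbourhood `s`. -/
def addVertex (n H s : ℕ) : ℕ := Nat.lor (addVertexAux n H s n) (Nat.shiftLeft s (Nat.mul 32 n))

/-- The possible neighbourhoods of further vertices after a vertex `n` of neighbourhood `s` is
added. -/
def extendCands (F H n s : ℕ) (C : List ℕ) : List ℕ :=
  List.rec (motive := fun _ => List ℕ) [] (fun t _ ih =>
    force (Nat.lor t (Nat.shiftLeft 1 n)) fun u =>
      select (bad F H n s u) (select (bad F H n s t) ih (t :: ih))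
        (u :: select (bad F H n s t) ih (t :: ih))) C

def filter (p : ℕ → Bool) (C : List ℕ) : List ℕ :=
  List.rec (motive := fun _ => List ℕ) [] (fun t _ ih => select (p t) (t :: ih) ih) C

abbrev Solver := ℕ → ℕ → List ℕ → Bool

def extend (n H : ℕ) (C : List ℕ) (s : ℕ) (k : Solver) : Bool :=
  select (Nat.ble n 30) (force (addVertex n H s) fun H' => force (Nat.succ n) fun n' =>
    force (Nat.sub (Nat.shiftLeft 1 n') 1) fun F => k n' H' (extendCands F H' n s C)) false

def clearTop (m : ℕ) : ℕ := Nat.xor m (Nat.shiftLeft 1 (Nat.log2 m))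

def comparable (F H : ℕ) : Option (ℕ × ℕ) :=
  findBit F fun a => force (row H a) fun ra =>
    findBit (compl F (Nat.lor ra (Nat.shiftLeft 1 a))) fun b =>
      select (Nat.beq (Nat.land ra (row H b)) ra) (some (a, b)) none

def lowDegree (F H : ℕ) : Option ℕ :=
  findBit F fun a => force (row H a) fun ra => force (clearTop ra) fun r =>
    select (Nat.beq r (Nat.shiftLeft 1 (Nat.log2 r))) (some a) none

def dominates (r x b : ℕ) : Bool :=
  Nat.beq (Nat.land r (Nat.lor x (Nat.shiftLeft 1 b))) r

def dominatedEdge (F H : ℕ) : Option ((ℕ × ℕ) × ℕ × ℕ) :=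
  findBit F fun a => force (row H a) fun ra => findBit ra fun b => force (row H b) fun rb =>
    force (compl F (Nat.lor (Nat.shiftLeft 1 a) (Nat.shiftLeft 1 b))) fun m =>
      findBit m fun x => force (row H x) fun rx =>
        select (dominates ra rx b) (findBit (Nat.land rx m) fun y =>
          select (dominates rb (row H y) a) (some ((a, b), (x, y))) none) none

/-- A set of neighbourhoods one of which must occur, forced by a defect of the current graph. -/
def witnesses (crit : Bool) (F H : ℕ) (C : List ℕ) : Option (List ℕ) :=
  match comparable F H with
  | some (a, b) => some (filter (fun t => select (mem t a) (select (mem t b) false true) false) C)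
  | none => select crit (match lowDegree F H with
      | some a => some (filter (fun t => mem t a) C)
      | none => match dominatedEdge F H with
        | some ((a, b), (x, y)) =>
          some (filter (fun t => select (select (mem t a) (select (mem t x) false true) false) true
            (select (mem t b) (select (mem t y) false true) false)) C)
        | none => none) none

def groetzschAt (F H r : ℕ) : Bool :=
  force (compl F r) fun m => anyBit m fun a => force (row H a) fun ra =>
    force (Nat.land m (Nat.sub (Nat.shiftLeft 1 a) 1)) fun m =>
    anyBit (Nat.land ra m) fun b => force (row H b) fun rb => anyBit (Nat.land rb m) fun c =>
      force (row H c) fun rc => select (Nat.beq (Nat.land r (Nat.land ra rc)) 0) false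
        (anyBit (Nat.land rc m) fun d => force (row H d) fun rd =>
          select (Nat.beq (Nat.land r (Nat.land rb rd)) 0) false
          (select (Nat.beq (Nat.land r (Nat.land rd ra)) 0) false
          (anyBit (Nat.land (Nat.land ra rd) m) fun e => force (row H e) fun re =>
            select (Nat.beq (Nat.land r (Nat.land rc re)) 0) false
            (select (Nat.beq (Nat.land r (Nat.land re rb)) 0) false true))))

def five (r : ℕ) : Bool :=
  force (clearTop r) fun r => force (clearTop r) fun r => force (clearTop r) fun r =>
    select (Nat.beq (clearTop r) 0) false true

def groetzsch (F H : ℕ) : Bool :=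
  anyBit F fun v => force (row H v) fun r => select (five r) (groetzschAt F H r) false

def branch (f : Solver) (n H : ℕ) (W : List ℕ) : List ℕ → Bool :=
  List.rec (motive := fun _ => List ℕ → Bool) (fun _ => true) (fun s _ ih C =>
    select (extend n H C s f) (ih (filter (fun t => select (Nat.beq t s) false true) C)) false) W

def coloring (H n : ℕ) : ℕ → ℕ → ℕ → Bool :=
  Nat.rec (motive := fun _ => ℕ → ℕ → ℕ → Bool) (fun _ _ _ => true)
    (fun k ih A B C => force (row H k) fun r =>
      select (select (Nat.beq (Nat.land r A) 0)
        (force (Nat.lor A (Nat.shiftLeft 1 k)) fun A => ih A B C) false) true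
      (select (select (Nat.beq (Nat.land r B) 0)
        (force (Nat.lor B (Nat.shiftLeft 1 k)) fun B => ih A B C) false) true
      (select (Nat.beq (Nat.land r C) 0)
        (force (Nat.lor C (Nat.shiftLeft 1 k)) fun C => ih A B C) false))) n

def clebschAdj (a b : ℕ) : Bool := mem 33046 (Nat.xor a b)

def clebschRow (c : ℕ) : ℕ :=
  List.rec (motive := fun _ => ℕ) 0 (fun x _ ih =>
    Nat.lor (Nat.shiftLeft ih 1) (select (clebschAdj c x) 1 0)) [0, 1, 3, 7, 8, 13, 2, 5, 12, 15, 9]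

def clebschCode (H i : ℕ) : Option ℕ :=
  findBit 65535 fun c => select (Nat.beq (clebschRow c) (Nat.land (row H i) 2047)) (some c) none

def allBelow (p : ℕ → Bool) (n : ℕ) : Bool :=
  Nat.rec (motive := fun _ => Bool) true (fun i ih => force i fun i => select (p i) ih false) n

def embeds (n H : ℕ) : Bool :=
  allBelow (fun i => allBelow (fun j => match clebschCode H i, clebschCode H j with
    | some c, some d => select (mem (row H i) j) (clebschAdj c d)
      (select (clebschAdj c d) false (select (Nat.beq c d) (Nat.beq i j) true))
    | _, _ => false) n) n

def final (crit : Bool) (n H : ℕ) : Bool :=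
  select crit (coloring H n 0 0 0) (embeds n H)

/-- Search for all ways to extend the graph `H` on `n` vertices by candidates from `C`. -/
def run (crit : Bool) (k : ℕ) : Solver :=
  Nat.rec (motive := fun _ => Solver) (fun _ _ _ => false) (fun _ ih n H C =>
    force (Nat.sub (Nat.shiftLeft 1 n) 1) fun F =>
      select (select crit (groetzsch F H) false) true
      (match witnesses crit F H C with
      | some W => branch ih n H W C
      | none => select (branch ih n H C C) (final crit n H) false)) k

def build (k : Solver) (l : List ℕ) : Solver :=
  List.rec (motive := fun _ => Solver) k (fun s _ ih n H C => extend n H C s ih) l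

/-- Search from the graph with successive neighbourhoods `l`, excluding the neighbourhood `x`. -/
def solve (crit : Bool) (l : List ℕ) (x : ℕ) : Bool :=
  build (fun n H C => run crit 20 n H (filter (fun t => select (Nat.beq t x) false true) C))
    l 0 0 [0]

section bits

theorem force_eq {α : Type} (x : ℕ) (k : ℕ → α) : force x k = k x := by cases x <;> rfl

theorem select_eq {α : Type} (b : Bool) (x y : α) : select b x y = if b = true then x else y := by
  cases b <;> rfl

theorem anyBit_sound {m : ℕ} {p : ℕ → Bool} (h : anyBit m p = true) :
    ∃ i, m.testBit i = true ∧ p i = true := by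
  unfold anyBit at h
  generalize 32 = k at h
  induction k generalizing m with
  | zero => cases h
  | succ k ih =>
    cases m with
    | zero => cases h
    | succ m =>
      have h' : force (Nat.log2 (Nat.succ m)) (fun i =>
        select (p i) true (anyBitAux p k (Nat.xor (Nat.succ m) (Nat.shiftLeft 1 i)))) = true := h
      rw [force_eq, select_eq] at h'
      have hlog : (m + 1).testBit (m + 1).log2 = true := Nat.testBit_log2 (by omega)
      split_ifs at h' with hp
      · exact ⟨_, hlog, hp⟩
      · obtain ⟨i, hi, hpi⟩ := ih h'
        refine ⟨i, ?_, hpi⟩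
        have h1 : Nat.testBit ((m + 1) ^^^ (1 <<< (m + 1).log2)) i = true := hi
        rw [Nat.testBit_xor, Nat.one_shiftLeft, Nat.testBit_two_pow] at h1
        by_cases hil : (m + 1).log2 = i
        · rw [← hil, hlog] at h1
          simp at h1
        · simpa [hil] using h1

theorem findBit_sound {α : Type} {m : ℕ} {p : ℕ → Option α} {x : α} (h : findBit m p = some x) :
    ∃ i, m.testBit i = true ∧ p i = some x := by
  unfold findBit at h
  generalize 32 = k at h
  induction k generalizing m with
  | zero => cases h
  | succ k ih =>
    cases m with
    | zero => cases h
    | succ m =>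
      have h' : force (Nat.log2 (Nat.succ m)) (fun i => Option.rec (motive := fun _ => Option α)
        (findBitAux p k (Nat.xor (Nat.succ m) (Nat.shiftLeft 1 i))) some (p i)) = some x := h
      rw [force_eq] at h'
      have hlog : (m + 1).testBit (m + 1).log2 = true := Nat.testBit_log2 (by omega)
      cases hp : p (m + 1).log2 with
      | some y =>
        rw [hp] at h'
        exact ⟨_, hlog, hp.trans h'⟩
      | none =>
        rw [hp] at h'
        obtain ⟨i, hi, hpi⟩ := ih h'
        refine ⟨i, ?_, hpi⟩
        have h1 : Nat.testBit ((m + 1) ^^^ (1 <<< (m + 1).log2)) i = true := hi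
        rw [Nat.testBit_xor, Nat.one_shiftLeft, Nat.testBit_two_pow] at h1
        by_cases hil : (m + 1).log2 = i
        · rw [← hil, hlog] at h1
          simp at h1
        · simpa [hil] using h1

theorem beq_eq {a b : ℕ} : Nat.beq a b = true ↔ a = b :=
  ⟨Nat.eq_of_beq_eq_true, by rintro rfl; simp⟩

theorem mem_eq (m i : ℕ) : mem m i = m.testBit i := by
  have h : mem m i = Nat.beq (m >>> i &&& 1) 1 := rfl
  rw [h, Bool.eq_iff_iff, beq_eq, Nat.testBit, Nat.and_comm, Nat.one_and_eq_mod_two]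
  simp

theorem compl_testBit {F a i : ℕ} :
    (compl F a).testBit i = true ↔ F.testBit i = true ∧ a.testBit i = false := by
  have h : compl F a = F ^^^ (F &&& a) := rfl
  rw [h, Nat.testBit_xor, Nat.testBit_and]
  cases F.testBit i <;> cases a.testBit i <;> simp

theorem land_testBit {a b i : ℕ} :
    (Nat.land a b).testBit i = true ↔ a.testBit i = true ∧ b.testBit i = true := by
  have h : Nat.land a b = a &&& b := rfl
  rw [h, Nat.testBit_and, Bool.and_eq_true]

theorem lor_testBit {a b i : ℕ} :
    (Nat.lor a b).testBit i = true ↔ a.testBit i = true ∨ b.testBit i = true := by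
  have h : Nat.lor a b = a ||| b := rfl
  rw [h, Nat.testBit_or, Bool.or_eq_true]

theorem lor_testBit_false {a b i : ℕ} :
    (Nat.lor a b).testBit i = false ↔ a.testBit i = false ∧ b.testBit i = false := by
  have h : Nat.lor a b = a ||| b := rfl
  rw [h, Nat.testBit_or, Bool.or_eq_false_iff]

theorem one_shiftLeft_testBit {i j : ℕ} : (Nat.shiftLeft 1 i).testBit j = true ↔ j = i := by
  have h : Nat.shiftLeft 1 i = 1 <<< i := rfl
  rw [h, Nat.one_shiftLeft, Nat.testBit_two_pow, decide_eq_true_iff, eq_comm]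

theorem full_testBit {n i : ℕ} :
    (Nat.sub (Nat.shiftLeft 1 n) 1).testBit i = true ↔ i < n := by
  have h : Nat.sub (Nat.shiftLeft 1 n) 1 = 1 <<< n - 1 := rfl
  rw [h, Nat.one_shiftLeft, Nat.testBit_two_pow_sub_one, decide_eq_true_iff]

theorem land_ne_zero {a b : ℕ} (h : ¬ Nat.beq (Nat.land a b) 0 = true) :
    ∃ i, a.testBit i = true ∧ b.testBit i = true := by
  by_contra hc
  push Not at hc
  refine h (beq_eq.2 (Nat.eq_of_testBit_eq fun i => ?_))
  rw [Nat.zero_testBit, ← Bool.not_eq_true, land_testBit]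
  exact fun hi => hc i hi.1 hi.2

theorem land_eq_left {a b i : ℕ} (h : Nat.land a b = a) (hi : a.testBit i = true) :
    b.testBit i = true := by
  rw [← h] at hi
  exact (land_testBit.1 hi).2

theorem row_testBit {H i j : ℕ} :
    (row H i).testBit j = true ↔ j < 32 ∧ H.testBit (32 * i + j) = true := by
  have h : row H i = (H >>> (32 * i)) &&& (2 ^ 32 - 1) := rfl
  rw [h, Nat.testBit_and, Nat.testBit_shiftRight, Nat.testBit_two_pow_sub_one]
  simp [and_comm]

theorem addVertexAux_testBit {n H s k i j : ℕ} (hn : n < 32) (hj : j < 32) :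
    (addVertexAux n H s k).testBit (32 * i + j) = true ↔
      i < k ∧ ((row H i).testBit j = true ∨ s.testBit i = true ∧ j = n) := by
  induction k with
  | zero =>
    have h : addVertexAux n H s 0 = 0 := rfl
    simp [h]
  | succ k ih =>
    have h : addVertexAux n H s (k + 1) = Nat.lor (addVertexAux n H s k)
        (Nat.shiftLeft (Nat.lor (row H k) (select (mem s k) (Nat.shiftLeft 1 n) 0))
          (Nat.mul 32 k)) := by
      have h' : addVertexAux n H s (k + 1) = force (addVertexAux n H s k) (fun ih =>
        force k fun i => Nat.lor ih (Nat.shiftLeft (Nat.lor (row H i)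
          (select (mem s i) (Nat.shiftLeft 1 n) 0)) (Nat.mul 32 i))) := rfl
      rw [h', force_eq, force_eq]
    have h2 : ∀ x l : ℕ, (Nat.shiftLeft x (Nat.mul 32 k)).testBit l = true ↔
        32 * k ≤ l ∧ x.testBit (l - 32 * k) = true := by
      intro x l
      have : Nat.shiftLeft x (Nat.mul 32 k) = x <<< (32 * k) := rfl
      rw [this, Nat.testBit_shiftLeft]
      simp
    have h3 : ∀ l, (select (mem s k) (Nat.shiftLeft 1 n) 0).testBit l = true ↔
        s.testBit k = true ∧ l = n := by
      intro l
      rw [select_eq, mem_eq]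
      split_ifs with hs
      · rw [one_shiftLeft_testBit]; simp [hs]
      · simp [hs]
    rw [h, lor_testBit, ih, h2, lor_testBit, h3]
    constructor
    · rintro (⟨h1, h2⟩ | ⟨h1, h2⟩)
      · exact ⟨by omega, h2⟩
      · have hik : i = k := by
          by_contra hik
          have : 32 ≤ 32 * i + j - 32 * k := by omega
          rcases h2 with h2 | h2
          · have := (row_testBit.1 h2).1; omega
          · omega
        subst hik
        have : 32 * i + j - 32 * i = j := by omega
        rw [this] at h2
        exact ⟨by omega, h2⟩
    · rintro ⟨h1, h2⟩
      by_cases hik : i = k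
      · subst hik
        have : 32 * i + j - 32 * i = j := by omega
        exact Or.inr ⟨by omega, by rwa [this]⟩
      · exact Or.inl ⟨by omega, h2⟩

theorem row_addVertex {n H s i j : ℕ} (hn : n < 32) (hs : ∀ l, s.testBit l = true → l < n) :
    i ≤ n → ((row (addVertex n H s) i).testBit j = true ↔
      (i < n ∧ ((row H i).testBit j = true ∨ s.testBit i = true ∧ j = n)) ∨
      (i = n ∧ s.testBit j = true)) := by
  intro hi
  have h : addVertex n H s = addVertexAux n H s n ||| (s <<< (32 * n)) := rfl
  rw [row_testBit, h, Nat.testBit_or, Bool.or_eq_true, Nat.testBit_shiftLeft, Bool.and_eq_true,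
    decide_eq_true_iff]
  by_cases hj : j < 32
  · rw [addVertexAux_testBit hn hj]
    constructor
    · rintro ⟨-, h | ⟨h1, h2⟩⟩
      · exact Or.inl h
      · have := hs _ h2
        have hin : i = n := by omega
        subst hin
        have : 32 * i + j - 32 * i = j := by omega
        rw [this] at h2
        exact Or.inr ⟨rfl, h2⟩
    · rintro (h | ⟨rfl, h'⟩)
      · exact ⟨hj, Or.inl h⟩
      · have hij : 32 * i + j - 32 * i = j := by omega
        exact ⟨hj, Or.inr ⟨by omega, by rwa [hij]⟩⟩
  · constructor
    · rintro ⟨h, -⟩; exact absurd h hj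
    · rintro (⟨-, h' | h'⟩ | ⟨rfl, h'⟩)
      · exact absurd (row_testBit.1 h').1 hj
      · omega
      · exact absurd (hs _ h') (by omega)

end bits
section Soundness

variable {V : Type*} {G : SimpleGraph V}

/-- `G` has no triangle and no induced `P2 ∪ P4`. -/
structure Basic (G : SimpleGraph V) : Prop where
  triangle : ∀ {a b c}, G.Adj a b → G.Adj b c → G.Adj c a → False
  path : ∀ {a b p q r s}, G.Adj a b → G.Adj p q → G.Adj q r → G.Adj r s → ¬ G.Adj p s →
    (∀ x ∈ [p, q, r, s], ¬ G.Adj a x ∧ ¬ G.Adj b x) → False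

/-- `t` is the neighbourhood of `v` within `f 0, …, f (n - 1)`. -/
def IsType (G : SimpleGraph V) (f : ℕ → V) (n t : ℕ) (v : V) : Prop :=
  ∀ i, t.testBit i = true ↔ i < n ∧ G.Adj v (f i)

structure Model (G : SimpleGraph V) (f : ℕ → V) (n H : ℕ) : Prop where
  row : ∀ i < n, IsType G f n (row H i) (f i)
  inj : ∀ i < n, ∀ j < n, f i = f j → i = j

def Outside (f : ℕ → V) (n : ℕ) (v : V) : Prop := ∀ i < n, f i ≠ v

def Covers (G : SimpleGraph V) (f : ℕ → V) (n : ℕ) (C : List ℕ) : Prop :=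
  ∀ v, Outside f n v → ∃ t ∈ C, IsType G f n t v

theorem IsType.not_adj {f : ℕ → V} {n t i : ℕ} {v : V} (h : IsType G f n t v) (hi : i < n)
    (ht : t.testBit i = false) : ¬ G.Adj v (f i) := fun ha => by
  rw [(h i).2 ⟨hi, ha⟩] at ht
  cases ht

theorem p4From_sound (hG : Basic G) {f : ℕ → V} {n H m t : ℕ} (hM : Model G f n H)
    {a b p : V} (ht : IsType G f n t p) (hab : G.Adj a b) (hap : ¬ G.Adj a p)
    (hbp : ¬ G.Adj b p)
    (hm : ∀ i, m.testBit i = true → i < n ∧ ¬ G.Adj a (f i) ∧ ¬ G.Adj b (f i)) :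
    p4From H m t = false := by
  rw [← Bool.not_eq_true]
  intro h
  rw [p4From, force_eq, force_eq] at h
  obtain ⟨c, hc, h⟩ := anyBit_sound h
  obtain ⟨d, hd, h⟩ := anyBit_sound h
  rw [select_eq] at h
  rw [land_testBit] at hc hd
  have hcn := (ht c).1 hc.1
  have hdn := (hM.row c hcn.1 d).1 hd.1
  obtain ⟨e, he⟩ : ∃ e, (Nat.land (row H d) m).testBit e ≠ (Nat.land t m).testBit e := by
    by_contra hcon
    push Not at hcon
    rw [beq_eq.2 (Nat.eq_of_testBit_eq hcon)] at h
    simp at h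
  have hem : m.testBit e = true := by
    by_contra hem
    apply he
    rw [Bool.eq_iff_iff, land_testBit, land_testBit]
    simp [hem]
  have he' : ¬ (G.Adj (f d) (f e) ↔ G.Adj p (f e)) := by
    intro hiff
    apply he
    rw [Bool.eq_iff_iff, land_testBit, land_testBit, hM.row d hdn.1, ht, hiff]
  have hme := hm e hem
  have hmc := hm c hc.2
  have hmd := hm d hd.2
  by_cases h1 : G.Adj p (f e)
  · have h2 : ¬ G.Adj (f d) (f e) := fun h2 => he' ⟨fun _ => h1, fun _ => h2⟩
    refine hG.path hab h1.symm hcn.2 hdn.2 (fun h => h2 h.symm) ?_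
    simp [hap, hbp, hme.2, hmc.2, hmd.2]
  · have h2 : G.Adj (f d) (f e) := by
      by_contra h2
      exact he' ⟨fun h => absurd h h2, fun h => absurd h h1⟩
    refine hG.path hab hcn.2 hdn.2 h2 h1 ?_
    simp [hap, hbp, hme.2, hmc.2, hmd.2]

theorem bad_sound (hG : Basic G) {f : ℕ → V} {n F H w t : ℕ} (hM : Model G f n H)
    (hF : ∀ i, F.testBit i = true ↔ i < n) (hw : w < n) {v : V} (ht : IsType G f n t v) :
    bad F H w (row H w) t = false := by
  have hr := hM.row w hw
  have hcompl : ∀ {x y : V} {s r : ℕ}, IsType G f n s x → IsType G f n r y → ∀ i,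
      (compl F (Nat.lor s r)).testBit i = true →
      i < n ∧ ¬ G.Adj x (f i) ∧ ¬ G.Adj y (f i) := by
    intro x y s r hs hr i hi
    rw [compl_testBit, hF, lor_testBit_false] at hi
    exact ⟨hi.1, hs.not_adj hi.1 hi.2.1, hr.not_adj hi.1 hi.2.2⟩
  rw [← Bool.not_eq_true]
  intro h
  rw [bad, select_eq] at h
  split_ifs at h with h1
  · rw [select_eq] at h1
    split_ifs at h1 with hwt
    · rw [mem_eq, ht] at hwt
      rw [select_eq] at h1
      split_ifs at h1 with hz
      · rw [force_eq] at h1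
        obtain ⟨y, hy, h1⟩ := anyBit_sound h1
        have hy' := hcompl ht hr y hy
        rw [p4From_sound hG hM (hM.row y hy'.1) hwt.2 hy'.2.1 hy'.2.2 (hcompl ht hr)] at h1
        cases h1
      · obtain ⟨i, hi, hi'⟩ := land_ne_zero hz
        rw [hr] at hi
        rw [ht] at hi'
        exact hG.triangle hwt.2 hi.2 hi'.2.symm
    · rw [mem_eq, Bool.not_eq_true] at hwt
      have hvw := ht.not_adj hw hwt
      rw [select_eq] at h1
      split_ifs at h1 with h2
      · obtain ⟨a, ha, h2⟩ := anyBit_sound h2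
        rw [compl_testBit, hr] at ha
        rw [p4From_sound hG hM ht ha.1.2 (fun h => hvw h.symm)
          (fun h => ht.not_adj ha.1.1 ha.2 h.symm) (hcompl hr (hM.row a ha.1.1))] at h2
        cases h2
      · obtain ⟨a, ha, h1⟩ := anyBit_sound h1
        rw [compl_testBit, ht] at ha
        rw [p4From_sound hG hM hr ha.1.2 hvw (fun h => hr.not_adj ha.1.1 ha.2 h.symm)
          (hcompl ht (hM.row a ha.1.1))] at h1
        cases h1
  · rw [edgeAny, force_eq] at h
    obtain ⟨a, ha, h⟩ := anyBit_sound h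
    rw [force_eq] at h
    obtain ⟨b, hb, h⟩ := anyBit_sound h
    rw [land_testBit, land_testBit] at hb
    have ha' := hcompl ht hr a ha
    have hb' := hcompl ht hr b hb.1.2
    have hab := (hM.row a ha'.1 b).1 hb.1.1
    rw [p4From_sound hG hM ht hab.2 (fun h => ha'.2.1 h.symm) (fun h => hb'.2.1 h.symm)
      (hcompl (hM.row a ha'.1) (hM.row b hb'.1))] at h
    cases h

theorem mem_filter {p : ℕ → Bool} {C : List ℕ} {t : ℕ} :
    t ∈ filter p C ↔ t ∈ C ∧ p t = true := by
  induction C with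
  | nil => simp [filter]
  | cons s C ih =>
    have h : filter p (s :: C) = select (p s) (s :: filter p C) (filter p C) := rfl
    rw [h, select_eq]
    split_ifs with hs
    · rw [List.mem_cons, List.mem_cons, ih]
      constructor
      · rintro (rfl | h)
        · exact ⟨Or.inl rfl, hs⟩
        · exact ⟨Or.inr h.1, h.2⟩
      · rintro ⟨rfl | h, h'⟩
        · exact Or.inl rfl
        · exact Or.inr ⟨h, h'⟩
    · rw [List.mem_cons, ih]
      constructor
      · exact fun h => ⟨Or.inr h.1, h.2⟩
      · rintro ⟨rfl | h, h'⟩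
        · exact absurd h' hs
        · exact ⟨h, h'⟩

theorem mem_extendCands {F H n r : ℕ} {C : List ℕ} {t u : ℕ} (ht : t ∈ C)
    (hu : u = t ∨ u = Nat.lor t (Nat.shiftLeft 1 n)) (hb : bad F H n r u = false) :
    u ∈ extendCands F H n r C := by
  induction C with
  | nil => cases ht
  | cons s C ih =>
    have h : extendCands F H n r (s :: C) = force (Nat.lor s (Nat.shiftLeft 1 n)) fun u =>
      select (bad F H n r u)
        (select (bad F H n r s) (extendCands F H n r C) (s :: extendCands F H n r C))
        (u :: select (bad F H n r s) (extendCands F H n r C) (s :: extendCands F H n r C)) := rfl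
    rw [h, force_eq]
    simp only [select_eq]
    rcases List.mem_cons.1 ht with rfl | ht
    · rcases hu with rfl | rfl
      · rw [hb]
        split_ifs <;> simp_all
      · rw [hb]
        simp
    · have := ih ht
      split_ifs <;> simp [this]

theorem model_extend (hG : Basic G) {f : ℕ → V} {n H s : ℕ} {C : List ℕ} (hn : n ≤ 30)
    (hM : Model G f n H) (hC : Covers G f n C) {v : V} (hv : Outside f n v)
    (hs : IsType G f n s v) :
    Model G (Function.update f n v) (n + 1) (addVertex n H s) ∧
    Covers G (Function.update f n v) (n + 1)
      (extendCands (Nat.sub (Nat.shiftLeft 1 (n + 1)) 1) (addVertex n H s) n s C) := by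
  have hlt : ∀ i < n, Function.update f n v i = f i := fun i hi =>
    Function.update_of_ne (by omega) _ _
  have hself : Function.update f n v n = v := Function.update_self ..
  have hrow : ∀ i ≤ n, ∀ j, (row (addVertex n H s) i).testBit j = true ↔
      (i < n ∧ ((row H i).testBit j = true ∨ s.testBit i = true ∧ j = n)) ∨
      (i = n ∧ s.testBit j = true) := fun i hi j =>
    row_addVertex (by omega) (fun l hl => ((hs l).1 hl).1) hi
  have hM' : Model G (Function.update f n v) (n + 1) (addVertex n H s) := by
    refine ⟨fun i hi j => ?_, fun i hi j hj h => ?_⟩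
    · rw [hrow i (by omega)]
      by_cases hin : i = n
      · subst hin
        rw [hself, hs j]
        by_cases hj : j < i
        · simp [hj, hlt j hj, Nat.lt_succ_of_lt hj]
        · by_cases hji : j = i
          · subst hji
            simp
          · simp [hj]
            omega
      · have hi' : i < n := by omega
        rw [hlt i hi', hM.row i hi' j, hs i]
        by_cases hj : j < n
        · simp [hi', hj, hlt j hj, Nat.lt_succ_of_lt hj, hin]
          omega
        · by_cases hjn : j = n
          · subst hjn
            simp [hi', hin, G.adj_comm]
          · simp [hj, hjn, hin]
            omega
    · by_cases hin : i = n <;> by_cases hjn : j = n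
      · omega
      · subst hin
        rw [hself, hlt j (by omega)] at h
        exact absurd h.symm (hv j (by omega))
      · subst hjn
        rw [hself, hlt i (by omega)] at h
        exact absurd h (hv i (by omega))
      · rw [hlt i (by omega), hlt j (by omega)] at h
        exact hM.inj i (by omega) j (by omega) h
  refine ⟨hM', fun x hx => ?_⟩
  have hx' : Outside f n x := fun i hi => by
    have := hx i (by omega)
    rwa [hlt i hi] at this
  obtain ⟨t, ht, htx⟩ := hC x hx'
  have hsrow : s = row (addVertex n H s) n := Nat.eq_of_testBit_eq fun j => by
    rw [Bool.eq_iff_iff, hrow n le_rfl]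
    simp
  have key : ∀ u, (u = t ∨ u = Nat.lor t (Nat.shiftLeft 1 n)) →
      IsType G (Function.update f n v) (n + 1) u x → ∃ t ∈ extendCands
        (Nat.sub (Nat.shiftLeft 1 (n + 1)) 1) (addVertex n H s) n s C,
        IsType G (Function.update f n v) (n + 1) t x := by
    intro u hu hux
    refine ⟨u, mem_extendCands ht hu ?_, hux⟩
    have := bad_sound hG hM' (fun i => full_testBit) (Nat.lt_succ_self n) hux
    rwa [← hsrow] at this
  by_cases hxv : G.Adj x v
  · refine key _ (Or.inr rfl) fun j => ?_
    rw [lor_testBit, one_shiftLeft_testBit, htx]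
    by_cases hj : j < n
    · simp [hj, hlt j hj, Nat.lt_succ_of_lt hj]
      omega
    · by_cases hjn : j = n
      · subst hjn
        simp [hxv]
      · simp [hj, hjn]
        omega
  · refine key _ (Or.inl rfl) fun j => ?_
    rw [htx]
    by_cases hj : j < n
    · simp [hj, hlt j hj, Nat.lt_succ_of_lt hj]
    · by_cases hjn : j = n
      · subst hjn
        simp [hxv]
      · simp [hj]
        omega

/-- A solver is sound for `Q` if its success on a state realized in `G` implies `Q`. -/
def Sound (G : SimpleGraph V) (Q : Prop) (k : Solver) : Prop :=
  ∀ n H C, k n H C = true → ∀ f : ℕ → V, Model G f n H → Covers G f n C → Q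

theorem extend_sound (hG : Basic G) {Q : Prop} {k : Solver} (hk : Sound G Q k)
    {f : ℕ → V} {n H s : ℕ} {C : List ℕ} (h : extend n H C s k = true) (hM : Model G f n H)
    (hC : Covers G f n C) {v : V} (hv : Outside f n v) (hs : IsType G f n s v) : Q := by
  rw [extend, select_eq] at h
  split_ifs at h with hn
  rw [force_eq, force_eq, force_eq] at h
  obtain ⟨h1, h2⟩ := model_extend hG (Nat.le_of_ble_eq_true hn) hM hC hv hs
  exact hk _ _ _ h _ h1 h2

theorem branch_sound (hG : Basic G) {Q : Prop} {k : Solver} (hk : Sound G Q k)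
    {f : ℕ → V} {n H : ℕ} {W C : List ℕ} (h : branch k n H W C = true) (hM : Model G f n H)
    (hC : Covers G f n C) (hQ : ¬ Q) : ∀ s ∈ W, ∀ v, Outside f n v → ¬ IsType G f n s v := by
  induction W generalizing C with
  | nil => simp
  | cons s W ih =>
    have h' : select (extend n H C s k)
      (branch k n H W (filter (fun t => select (Nat.beq t s) false true) C)) false = true := h
    rw [select_eq] at h'
    split_ifs at h' with he
    have hs : ∀ v, Outside f n v → ¬ IsType G f n s v := fun v hv hs =>
      hQ (extend_sound hG hk he hM hC hv hs)
    intro t ht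
    rcases List.mem_cons.1 ht with rfl | ht
    · exact hs
    · refine ih h' (fun v hv => ?_) t ht
      obtain ⟨t, ht, htv⟩ := hC v hv
      refine ⟨t, mem_filter.2 ⟨ht, ?_⟩, htv⟩
      rw [select_eq, if_neg]
      rw [beq_eq]
      rintro rfl
      exact hs v hv htv

end Soundness
section Solver

variable {V : Type*} {G : SimpleGraph V}

instance : DecidableRel GrotzschGraph.Adj := fun i j => decidable_of_iff
  (s(i, j) ∈ ({s(0,1), s(0,2), s(0,3), s(0,4), s(0,5),
     s(6,7), s(7,8), s(8,9), s(9,10), s(6,10),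
     s(1,6), s(1,8), s(2,7), s(2,9), s(3,8), s(3,10), s(4,9), s(4,6), s(5,10), s(5,7)} :
     Finset (Sym2 (Fin 11))))
  (by
    rw [GrotzschGraph, SimpleGraph.fromEdgeSet_adj, ← Finset.mem_coe]
    simp only [Finset.coe_insert, Finset.coe_singleton]
    refine ⟨fun h => ⟨h, ?_⟩, fun h => h.1⟩
    rintro rfl
    simp at h
    omega)

theorem groetzsch_diameter : ∀ i j : Fin 11, i ≠ j → ¬ GrotzschGraph.Adj i j →
    (∃ k, GrotzschGraph.Adj i k ∧ GrotzschGraph.Adj k j) ∧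
    (∃ k, k ≠ j ∧ GrotzschGraph.Adj k i ∧ ¬ GrotzschGraph.Adj k j) := by decide +kernel

/-- Every homomorphism from the Grötzsch graph to a triangle-free graph is an induced embedding. -/
theorem containsInduced_groetzsch (hG : Basic G) (f : Fin 11 → V)
    (hf : ∀ i j, GrotzschGraph.Adj i j → G.Adj (f i) (f j)) : ContainsInduced GrotzschGraph G := by
  have hadj : ∀ i j, i ≠ j → (G.Adj (f i) (f j) ↔ GrotzschGraph.Adj i j) := by
    refine fun i j hij => ⟨fun h => ?_, hf i j⟩
    by_contra hn
    obtain ⟨k, h1, h2⟩ := (groetzsch_diameter i j hij hn).1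
    exact hG.triangle h.symm (hf _ _ h1) (hf _ _ h2)
  have hinj : Function.Injective f := by
    intro i j h
    by_contra hij
    by_cases hn : GrotzschGraph.Adj i j
    · exact G.irrefl (h ▸ hf i j hn : G.Adj (f j) (f j))
    · obtain ⟨k, hkj, h1, h2⟩ := (groetzsch_diameter i j hij hn).2
      exact h2 ((hadj k j hkj).1 (h ▸ hf k i h1))
  refine ⟨⟨f, hinj⟩, fun i j => ?_⟩
  by_cases hij : i = j
  · subst hij; simp
  · exact hadj i j hij

theorem containsInduced_groetzsch_of_adj (hG : Basic G) {v w₁ w₂ w₃ w₄ w₅ a b c d e : V}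
    (h : (G.Adj v w₁ ∧ G.Adj v w₂ ∧ G.Adj v w₃ ∧ G.Adj v w₄ ∧ G.Adj v w₅) ∧
      (G.Adj a b ∧ G.Adj b c ∧ G.Adj c d ∧ G.Adj d e ∧ G.Adj a e) ∧
      (G.Adj w₁ a ∧ G.Adj w₂ b ∧ G.Adj w₃ c ∧ G.Adj w₄ d ∧ G.Adj w₅ e) ∧
      (G.Adj w₁ c ∧ G.Adj w₂ d ∧ G.Adj w₃ e ∧ G.Adj w₄ a ∧ G.Adj w₅ b)) :
    ContainsInduced GrotzschGraph G := by
  refine containsInduced_groetzsch hG ![v, w₁, w₂, w₃, w₄, w₅, a, b, c, d, e] ?_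
  have : GrotzschGraph ≤ G.comap ![v, w₁, w₂, w₃, w₄, w₅, a, b, c, d, e] := by
    rw [GrotzschGraph, SimpleGraph.fromEdgeSet_le]
    refine Set.sdiff_subset.trans ?_
    simp [Set.insert_subset_iff, h]
  exact fun i j hij => this hij

theorem groetzsch_sound (hG : Basic G) {f : ℕ → V} {n F H : ℕ} (hM : Model G f n H)
    (hF : ∀ i, F.testBit i = true ↔ i < n) (h : groetzsch F H = true) :
    ContainsInduced GrotzschGraph G := by
  obtain ⟨v, hv, h⟩ := anyBit_sound h
  rw [hF] at hv
  rw [force_eq, select_eq] at h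
  split_ifs at h
  rw [groetzschAt, force_eq] at h
  obtain ⟨a, ha, h⟩ := anyBit_sound h
  have han := (hF a).1 (compl_testBit.1 ha).1
  rw [force_eq, force_eq] at h
  obtain ⟨b, hb, h⟩ := anyBit_sound h
  rw [force_eq] at h
  obtain ⟨c, hc, h⟩ := anyBit_sound h
  rw [force_eq, select_eq] at h
  split_ifs at h with hw1
  obtain ⟨d, hd, h⟩ := anyBit_sound h
  rw [force_eq, select_eq] at h
  split_ifs at h with hw2
  rw [select_eq] at h
  split_ifs at h with hw4
  obtain ⟨e, he, h⟩ := anyBit_sound h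
  rw [force_eq, select_eq] at h
  split_ifs at h with hw3
  rw [select_eq] at h
  split_ifs at h with hw5
  have hb' := (hM.row a han b).1 (land_testBit.1 hb).1
  have hc' := (hM.row b hb'.1 c).1 (land_testBit.1 hc).1
  have hd' := (hM.row c hc'.1 d).1 (land_testBit.1 hd).1
  have he' := land_testBit.1 (land_testBit.1 he).1
  have hea := (hM.row a han e).1 he'.1
  have hed := (hM.row d hd'.1 e).1 he'.2
  have hw : ∀ {x y}, x < n → y < n →
      ¬ Nat.beq (Nat.land (row H v) (Nat.land (row H x) (row H y))) 0 = true →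
      ∃ i, G.Adj (f v) (f i) ∧ G.Adj (f x) (f i) ∧ G.Adj (f y) (f i) := by
    intro x y hx hy h
    obtain ⟨i, hi, hi'⟩ := land_ne_zero h
    rw [land_testBit, hM.row x hx, hM.row y hy] at hi'
    exact ⟨i, ((hM.row v hv i).1 hi).2, hi'.1.2, hi'.2.2⟩
  obtain ⟨i₁, h₁⟩ := hw han hc'.1 hw1
  obtain ⟨i₂, h₂⟩ := hw hb'.1 hd'.1 hw2
  obtain ⟨i₃, h₃⟩ := hw hc'.1 hea.1 hw3
  obtain ⟨i₄, h₄⟩ := hw hd'.1 han hw4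
  obtain ⟨i₅, h₅⟩ := hw hea.1 hb'.1 hw5
  exact containsInduced_groetzsch_of_adj hG (v := f v) (w₁ := f i₁) (w₂ := f i₂) (w₃ := f i₃)
    (w₄ := f i₄) (w₅ := f i₅) (a := f a) (b := f b) (c := f c) (d := f d) (e := f e)
    ⟨⟨h₁.1, h₂.1, h₃.1, h₄.1, h₅.1⟩, ⟨hb'.2, hc'.2, hd'.2, hed.2, hea.2⟩,
      ⟨h₁.2.1.symm, h₂.2.1.symm, h₃.2.1.symm, h₄.2.1.symm, h₅.2.1.symm⟩,
      ⟨h₁.2.2.symm, h₂.2.2.symm, h₃.2.2.symm, h₄.2.2.symm, h₅.2.2.symm⟩⟩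

theorem coloring_sound {f : ℕ → V} {n H k A B C : ℕ} (hM : Model G f n H) (hk : k ≤ n)
    (h : coloring H k A B C = true) : ∃ c : ℕ → Fin 3,
      (∀ i < k, ∀ j, (row H i).testBit j = true → (![A, B, C] (c i)).testBit j = false) ∧
      ∀ i < k, ∀ j < k, G.Adj (f i) (f j) → c i ≠ c j := by
  induction k generalizing A B C with
  | zero => exact ⟨fun _ => 0, by simp, by simp⟩
  | succ k ih =>
    have h' : force (row H k) (fun r =>
      select (select (Nat.beq (Nat.land r A) 0)
        (force (Nat.lor A (Nat.shiftLeft 1 k)) fun A => coloring H k A B C) false) true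
      (select (select (Nat.beq (Nat.land r B) 0)
        (force (Nat.lor B (Nat.shiftLeft 1 k)) fun B => coloring H k A B C) false) true
      (select (Nat.beq (Nat.land r C) 0)
        (force (Nat.lor C (Nat.shiftLeft 1 k)) fun C => coloring H k A B C) false))) = true := h
    have key : ∀ (x : Fin 3) (A' B' C' : ℕ), coloring H k A' B' C' = true →
        Nat.beq (Nat.land (row H k) (![A, B, C] x)) 0 = true →
        (∀ y j, (![A, B, C] y).testBit j = true → (![A', B', C'] y).testBit j = true) →
        (![A', B', C'] x).testBit k = true → ∃ c : ℕ → Fin 3,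
      (∀ i < k + 1, ∀ j, (row H i).testBit j = true → (![A, B, C] (c i)).testBit j = false) ∧
      ∀ i < k + 1, ∀ j < k + 1, G.Adj (f i) (f j) → c i ≠ c j := by
      intro x A' B' C' hcol hx hsub hxk
      obtain ⟨c, hc, hc'⟩ := ih (by omega) hcol
      have hne : ∀ i < k, G.Adj (f i) (f k) → c i ≠ x := by
        rintro i hi hik rfl
        have := hc i hi k ((hM.row i (by omega) k).2 ⟨by omega, hik⟩)
        rw [hxk] at this
        cases this
      have hu : ∀ i < k, Function.update c k x i = c i := fun i hi =>
        Function.update_of_ne (by omega) _ _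
      have hu' : Function.update c k x k = x := Function.update_self ..
      refine ⟨Function.update c k x, fun i hi j hj => ?_, fun i hi j hj hij => ?_⟩
      · rcases Nat.lt_succ_iff_lt_or_eq.1 hi with hi | rfl
        · rw [hu i hi, ← Bool.not_eq_true]
          intro hA
          have := hc i hi j hj
          rw [hsub _ _ hA] at this
          cases this
        · rw [hu', ← Bool.not_eq_true]
          intro hA
          have hb : (Nat.land (row H i) (![A, B, C] x)).testBit j = true := land_testBit.2 ⟨hj, hA⟩
          rw [beq_eq.1 hx, Nat.zero_testBit] at hb
          cases hb
      · rcases Nat.lt_succ_iff_lt_or_eq.1 hi with hi | rfl <;>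
        rcases Nat.lt_succ_iff_lt_or_eq.1 hj with hj | rfl
        · rw [hu i hi, hu j hj]; exact hc' i hi j hj hij
        · rw [hu i hi, hu']; exact hne i hi hij
        · rw [hu j hj, hu']; exact (hne j hj hij.symm).symm
        · exact absurd hij (G.irrefl)
    have hlor : ∀ A j, Nat.testBit A j = true →
        (Nat.lor A (Nat.shiftLeft 1 k)).testBit j = true := fun A j h => lor_testBit.2 (Or.inl h)
    have hlor' : ∀ A, (Nat.lor A (Nat.shiftLeft 1 k)).testBit k = true := fun A =>
      lor_testBit.2 (Or.inr (one_shiftLeft_testBit.2 rfl))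
    rw [force_eq, select_eq] at h'
    split_ifs at h' with h1
    · rw [select_eq] at h1
      split_ifs at h1 with h2
      rw [force_eq] at h1
      refine key 0 _ _ _ h1 h2 (fun y j hy => ?_) (hlor' _)
      fin_cases y
      exacts [hlor _ _ hy, hy, hy]
    · rw [select_eq] at h'
      split_ifs at h' with h1
      · rw [select_eq] at h1
        split_ifs at h1 with h2
        rw [force_eq] at h1
        refine key 1 _ _ _ h1 h2 (fun y j hy => ?_) (hlor' _)
        fin_cases y
        exacts [hy, hlor _ _ hy, hy]
      · rw [select_eq] at h'
        split_ifs at h' with h2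
        rw [force_eq] at h'
        refine key 2 _ _ _ h' h2 (fun y j hy => ?_) (hlor' _)
        fin_cases y
        exacts [hy, hy, hlor _ _ hy]

theorem allBelow_sound {p : ℕ → Bool} {n : ℕ} (h : allBelow p n = true) :
    ∀ i < n, p i = true := by
  induction n with
  | zero => simp
  | succ n ih =>
    have h' : force n (fun i => select (p i) (allBelow p n) false) = true := h
    rw [force_eq, select_eq] at h'
    split_ifs at h' with hp
    intro i hi
    rcases Nat.lt_succ_iff_lt_or_eq.1 hi with hi | rfl
    · exact ih h' i hi
    · exact hp

/-- The vertex of the Clebsch graph whose coordinates are the binary digits of `c`. -/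
def clebschVertex (c : ℕ) : Fin 4 → ZMod 2 := fun k => if c.testBit k then 1 else 0

instance : DecidableRel ClebschGraph.Adj := fun x y => decidable_of_iff
  (x ≠ y ∧ (x - y ∈ ({Pi.single 0 1, Pi.single 1 1, Pi.single 2 1, Pi.single 3 1, 1} :
    Finset (Fin 4 → ZMod 2)) ∨ y - x ∈ ({Pi.single 0 1, Pi.single 1 1, Pi.single 2 1,
    Pi.single 3 1, 1} : Finset (Fin 4 → ZMod 2)))) (by simp [ClebschGraph])

theorem clebschVertex_adj : ∀ c < 16, ∀ d < 16,
    (ClebschGraph.Adj (clebschVertex c) (clebschVertex d) ↔ clebschAdj c d = true) ∧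
    (clebschVertex c = clebschVertex d → c = d) := by decide +kernel

theorem embeds_sound {f : ℕ → V} {n H : ℕ} (hM : Model G f n H) (hs : ∀ v, ¬ Outside f n v)
    (h : embeds n H = true) : ContainsInduced G ClebschGraph := by
  have hidx : ∀ v, ∃ i < n, f i = v := fun v => by simpa [Outside] using hs v
  choose idx hidx hf using hidx
  have hcode : ∀ i < n, ∀ j < n, ∃ c d, clebschCode H i = some c ∧ clebschCode H j = some d ∧
      ((row H i).testBit j = true ↔ clebschAdj c d = true) ∧ (c = d → i = j) := by
    intro i hi j hj
    have h := allBelow_sound (allBelow_sound h i hi) j hj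
    split at h
    · rename_i c d hc hd
      refine ⟨c, d, hc, hd, ?_⟩
      simp only [select_eq, mem_eq] at h
      by_cases h1 : (row H i).testBit j = true
      · simp only [h1, if_true] at h
        refine ⟨by simp [h1, h], ?_⟩
        rintro rfl
        simp [clebschAdj, mem_eq] at h
      · by_cases h2 : clebschAdj c d = true
        · simp [h1, h2] at h
        · refine ⟨by simp [h1, h2], ?_⟩
          rintro rfl
          have : Nat.beq c c = true := beq_eq.2 rfl
          simp only [h1, h2, this] at h
          exact beq_eq.1 (by simpa using h)
    · cases h
  have hlt : ∀ i c, clebschCode H i = some c → c < 16 := by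
    intro i c h
    obtain ⟨j, hj, h⟩ := findBit_sound h
    rw [select_eq] at h
    split_ifs at h
    obtain rfl := Option.some.inj h
    by_contra hc
    rw [Nat.testBit_lt_two_pow (lt_of_lt_of_le (by norm_num : 65535 < 2 ^ 16)
      (Nat.pow_le_pow_right (by norm_num) (not_lt.1 hc)))] at hj
    cases hj
  let g : V → Fin 4 → ZMod 2 := fun v => clebschVertex ((clebschCode H (idx v)).getD 0)
  have hg : ∀ u v, (ClebschGraph.Adj (g u) (g v) ↔ G.Adj u v) ∧ (g u = g v → u = v) := by
    intro u v
    obtain ⟨c, d, hc, hd, hcd, hne⟩ := hcode _ (hidx u) _ (hidx v)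
    obtain ⟨h1, h2⟩ := clebschVertex_adj c (hlt _ _ hc) d (hlt _ _ hd)
    simp only [g, hc, hd, Option.getD_some]
    refine ⟨?_, fun h => ?_⟩
    · rw [h1, ← hcd, hM.row _ (hidx u), hf, hf]
      simp [hidx]
    · rw [← hf u, ← hf v, hne (h2 h)]
  exact ⟨⟨g, fun u v h => (hg u v).2 h⟩, fun u v => (hg u v).1⟩

end Solver
section Run

variable {V : Type*} {G : SimpleGraph V}

/-- The properties of a vertex-critical graph, not 3-colourable and without induced Grötzsch
graph, that the search relies on. -/
structure Critical (G : SimpleGraph V) : Prop where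
  degree : ∀ v x y, ∃ w, G.Adj v w ∧ w ≠ x ∧ w ≠ y
  edge : ∀ {a b x y}, G.Adj a b → G.Adj x y → x ≠ a → x ≠ b → y ≠ a → y ≠ b →
    ∃ w, (G.Adj a w ∧ w ≠ b ∧ ¬ G.Adj x w) ∨ (G.Adj b w ∧ w ≠ a ∧ ¬ G.Adj y w)
  groetzsch : ¬ ContainsInduced GrotzschGraph G
  coloring : ¬ G.Colorable 3

def NoComparable (G : SimpleGraph V) : Prop :=
  ∀ u v, u ≠ v → ¬ G.Adj u v → ∃ w, G.Adj u w ∧ ¬ G.Adj v w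

theorem Covers.exists_type {f : ℕ → V} {n : ℕ} {C : List ℕ} (hC : Covers G f n C)
    {w : V} (hw : ∀ i < n, w ≠ f i) {p : ℕ → Bool}
    (hp : ∀ t, IsType G f n t w → p t = true) :
    ∃ t ∈ filter p C, ∃ v, Outside f n v ∧ IsType G f n t v := by
  have hw' : Outside f n w := fun i hi h => hw i hi h.symm
  obtain ⟨t, ht, htw⟩ := hC w hw'
  exact ⟨t, mem_filter.2 ⟨ht, hp t htw⟩, w, hw', htw⟩

theorem clearTop_testBit {m y i : ℕ} (h : clearTop m = Nat.shiftLeft 1 y)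
    (hi : m.testBit i = true) : i = m.log2 ∨ i = y := by
  have h' : m ^^^ Nat.shiftLeft 1 m.log2 = Nat.shiftLeft 1 y := h
  by_contra! hc
  have h1 : (m ^^^ Nat.shiftLeft 1 m.log2).testBit i = true := by
    rw [Nat.testBit_xor, hi, Bool.true_xor, Bool.not_eq_true', ← Bool.not_eq_true,
      one_shiftLeft_testBit]
    exact hc.1
  rw [h', one_shiftLeft_testBit] at h1
  exact hc.2 h1

theorem comparable_sound (hG : NoComparable G) {f : ℕ → V} {n F H a b : ℕ} {C : List ℕ}
    (hM : Model G f n H) (hC : Covers G f n C) (hF : ∀ i, F.testBit i = true ↔ i < n)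
    (h : comparable F H = some (a, b)) :
    ∃ t ∈ filter (fun t => select (mem t a) (select (mem t b) false true) false) C,
      ∃ v, Outside f n v ∧ IsType G f n t v := by
  obtain ⟨a', ha, h⟩ := findBit_sound h
  rw [hF] at ha
  rw [force_eq] at h
  obtain ⟨b', hb, h⟩ := findBit_sound h
  rw [select_eq] at h
  split_ifs at h with hab
  simp only [Option.some.injEq, Prod.mk.injEq] at h
  obtain ⟨rfl, rfl⟩ := h
  rw [compl_testBit, hF, lor_testBit_false, ← Bool.not_eq_true (Nat.testBit _ _),
    ← Bool.not_eq_true (Nat.testBit _ _), one_shiftLeft_testBit] at hb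
  obtain ⟨w, hw, hw'⟩ := hG (f a') (f b') (fun h => hb.2.2 (hM.inj _ ha _ hb.1 h).symm)
    (fun h => hb.2.1 ((hM.row _ ha _).2 ⟨hb.1, h⟩))
  refine hC.exists_type (w := w) ?_ fun t ht => ?_
  · rintro i hi rfl
    have := land_eq_left (beq_eq.1 hab) ((hM.row _ ha _).2 ⟨hi, hw⟩)
    exact hw' ((hM.row _ hb.1 _).1 this).2
  · have h1 : t.testBit a' = true := (ht _).2 ⟨ha, hw.symm⟩
    have h2 : ¬ t.testBit b' = true := fun h => hw' ((ht _).1 h).2.symm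
    simp [select_eq, mem_eq, h1, h2]

theorem lowDegree_sound (hG : Critical G) {f : ℕ → V} {n F H a : ℕ} {C : List ℕ}
    (hM : Model G f n H) (hC : Covers G f n C) (hF : ∀ i, F.testBit i = true ↔ i < n)
    (h : lowDegree F H = some a) :
    ∃ t ∈ filter (fun t => mem t a) C, ∃ v, Outside f n v ∧ IsType G f n t v := by
  obtain ⟨a', ha, h⟩ := findBit_sound h
  rw [hF] at ha
  rw [force_eq, force_eq, select_eq] at h
  split_ifs at h with hab
  obtain rfl := Option.some.inj h
  obtain ⟨w, hw, hx, hy⟩ := hG.degree (f a') (f (row H a').log2)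
    (f (clearTop (row H a')).log2)
  refine hC.exists_type (w := w) ?_ fun t ht => ?_
  · rintro i hi rfl
    rcases clearTop_testBit (beq_eq.1 hab) ((hM.row _ ha _).2 ⟨hi, hw⟩) with rfl | rfl
    · exact hx rfl
    · exact hy rfl
  · rw [mem_eq, ht]
    exact ⟨ha, hw.symm⟩

theorem dominates_testBit {r x b i : ℕ} (h : dominates r x b = true) (hi : r.testBit i = true) :
    x.testBit i = true ∨ i = b := by
  have := land_eq_left (beq_eq.1 h) hi
  rwa [lor_testBit, one_shiftLeft_testBit] at this

theorem dominatedEdge_sound (hG : Critical G) {f : ℕ → V} {n F H a b x y : ℕ} {C : List ℕ}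
    (hM : Model G f n H) (hC : Covers G f n C) (hF : ∀ i, F.testBit i = true ↔ i < n)
    (h : dominatedEdge F H = some ((a, b), (x, y))) :
    ∃ t ∈ filter (fun t => select (select (mem t a) (select (mem t x) false true) false) true
        (select (mem t b) (select (mem t y) false true) false)) C,
      ∃ v, Outside f n v ∧ IsType G f n t v := by
  obtain ⟨a', ha, h⟩ := findBit_sound h
  rw [hF] at ha
  rw [force_eq] at h
  obtain ⟨b', hb, h⟩ := findBit_sound h
  rw [hM.row _ ha] at hb
  rw [force_eq, force_eq] at h
  obtain ⟨x', hx, h⟩ := findBit_sound h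
  rw [force_eq, select_eq] at h
  split_ifs at h with hax
  obtain ⟨y', hy, h⟩ := findBit_sound h
  rw [select_eq] at h
  split_ifs at h with hby
  simp only [Option.some.injEq, Prod.mk.injEq] at h
  obtain ⟨⟨rfl, rfl⟩, rfl, rfl⟩ := h
  have hm : ∀ {z}, (compl F (Nat.lor (Nat.shiftLeft 1 a') (Nat.shiftLeft 1 b'))).testBit z = true →
      z < n ∧ f z ≠ f a' ∧ f z ≠ f b' := by
    intro z hz
    rw [compl_testBit, hF, lor_testBit_false, ← Bool.not_eq_true (Nat.testBit _ _),
      ← Bool.not_eq_true (Nat.testBit _ _), one_shiftLeft_testBit, one_shiftLeft_testBit] at hz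
    exact ⟨hz.1, fun h => hz.2.1 (hM.inj _ hz.1 _ ha h), fun h => hz.2.2 (hM.inj _ hz.1 _ hb.1 h)⟩
  obtain ⟨hxn, hxa, hxb⟩ := hm hx
  rw [land_testBit, hM.row _ hxn] at hy
  obtain ⟨hyn, hya, hyb⟩ := hm hy.2
  obtain ⟨w, hw⟩ := hG.edge hb.2 hy.1.2 hxa hxb hya hyb
  refine hC.exists_type (w := w) ?_ fun t ht => ?_
  · rintro i hi rfl
    rcases hw with ⟨h1, h2, h3⟩ | ⟨h1, h2, h3⟩
    · rcases dominates_testBit hax ((hM.row _ ha _).2 ⟨hi, h1⟩) with h | rfl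
      · exact h3 ((hM.row _ hxn _).1 h).2
      · exact h2 rfl
    · rcases dominates_testBit hby ((hM.row _ hb.1 _).2 ⟨hi, h1⟩) with h | rfl
      · exact h3 ((hM.row _ hyn _).1 h).2
      · exact h2 rfl
  · rcases hw with ⟨h1, h2, h3⟩ | ⟨h1, h2, h3⟩
    · have h4 : t.testBit a' = true := (ht _).2 ⟨ha, h1.symm⟩
      have h5 : ¬ t.testBit x' = true := fun h => h3 ((ht _).1 h).2.symm
      simp [select_eq, mem_eq, h4, h5]
    · have h4 : t.testBit b' = true := (ht _).2 ⟨hb.1, h1.symm⟩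
      have h5 : ¬ t.testBit y' = true := fun h => h3 ((ht _).1 h).2.symm
      simp [select_eq, mem_eq, h4, h5]

theorem witnesses_sound (hG : NoComparable G) {crit : Bool} (hcrit : crit = true → Critical G)
    {f : ℕ → V} {n F H : ℕ} {C W : List ℕ} (hM : Model G f n H) (hC : Covers G f n C)
    (hF : ∀ i, F.testBit i = true ↔ i < n) (h : witnesses crit F H C = some W) :
    ∃ t ∈ W, ∃ v, Outside f n v ∧ IsType G f n t v := by
  rw [witnesses] at h
  split at h
  · rename_i hab
    obtain rfl := Option.some.inj h
    exact comparable_sound hG hM hC hF hab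
  · rw [select_eq] at h
    split_ifs at h with hc
    split at h
    · rename_i ha
      obtain rfl := Option.some.inj h
      exact lowDegree_sound (hcrit hc) hM hC hF ha
    · split at h
      · rename_i hab
        obtain rfl := Option.some.inj h
        exact dominatedEdge_sound (hcrit hc) hM hC hF hab
      · cases h

theorem run_sound (hB : Basic G) (hG : NoComparable G) {crit : Bool}
    (hcrit : crit = true → Critical G) {Q : Prop}
    (hQ : crit = false → ContainsInduced G ClebschGraph → Q) (k : ℕ) :
    Sound G Q (run crit k) := by
  induction k with
  | zero => intro n H C h; cases h
  | succ k ih =>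
    intro n H C h f hM hC
    have h' : force (Nat.sub (Nat.shiftLeft 1 n) 1) (fun F =>
      select (select crit (groetzsch F H) false) true
      (match witnesses crit F H C with
      | some W => branch (run crit k) n H W C
      | none => select (branch (run crit k) n H C C) (final crit n H) false)) = true := h
    rw [force_eq, select_eq (select crit _ false)] at h'
    by_contra hQ'
    by_cases h1 : select crit (groetzsch (Nat.sub (Nat.shiftLeft 1 n) 1) H) false = true
    · rw [select_eq] at h1
      split_ifs at h1 with h2
      exact (hcrit h2).groetzsch (groetzsch_sound hB hM (fun i => full_testBit) h1)
    · rw [if_neg h1] at h'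
      split at h'
      · rename_i W hW
        obtain ⟨t, ht, v, hv, htv⟩ := witnesses_sound hG hcrit hM hC (fun i => full_testBit) hW
        exact branch_sound hB ih h' hM hC hQ' t ht v hv htv
      · rw [select_eq] at h'
        split_ifs at h' with h3
        have hout : ∀ v, ¬ Outside f n v := fun v hv => by
          obtain ⟨t, ht, htv⟩ := hC v hv
          exact branch_sound hB ih h3 hM hC hQ' t ht v hv htv
        cases crit with
        | true =>
          obtain ⟨c, -, hc⟩ := coloring_sound hM le_rfl h'
          have hidx : ∀ v, ∃ i < n, f i = v := fun v => by simpa [Outside] using hout v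
          choose idx hidx hf using hidx
          refine (hcrit rfl).coloring ⟨SimpleGraph.Coloring.mk (fun v => c (idx v)) ?_⟩
          intro u v huv
          exact hc _ (hidx u) _ (hidx v) (by rwa [hf, hf])
        | false => exact hQ' (hQ rfl (embeds_sound hM hout h'))

theorem build_sound (hB : Basic G) {Q : Prop} {k : Solver} {f : ℕ → V} {l : List ℕ} {m : ℕ}
    (hl : ∀ (i : ℕ) (hi : i < l.length), IsType G f (m + i) l[i] (f (m + i)))
    (hf : ∀ i < m + l.length, ∀ j < m + l.length, f i = f j → i = j)
    (hk : ∀ n H C, n = m + l.length → k n H C = true → ∀ g : ℕ → V, (∀ i < n, g i = f i) →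
      Model G g n H → Covers G g n C → Q)
    {H : ℕ} {C : List ℕ} (h : build k l m H C = true) {g : ℕ → V} (hg : ∀ i < m, g i = f i)
    (hM : Model G g m H) (hC : Covers G g m C) : Q := by
  induction l generalizing m H C g with
  | nil => exact hk m H C rfl h g hg hM hC
  | cons s l ih =>
    have h' : extend m H C s (build k l) = true := h
    rw [extend, select_eq] at h'
    split_ifs at h' with hn
    rw [force_eq, force_eq, force_eq] at h'
    have hlen : m + (s :: l).length = m + 1 + l.length := by simp; omega
    have hv : Outside g m (f m) := by
      intro i hi h
      rw [hg i hi] at h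
      have := hf i (by simp; omega) m (by simp) h
      omega
    have hs : IsType G g m s (f m) := by
      intro i
      have := hl 0 (by simp) i
      simp only [Nat.add_zero, List.getElem_cons_zero] at this
      rw [this]
      exact and_congr_right fun hi => by rw [hg i hi]
    obtain ⟨h1, h2⟩ := model_extend hB (Nat.le_of_ble_eq_true hn) hM hC hv hs
    refine ih (fun i hi => ?_) (by rwa [← hlen]) (fun n H C hn => hk n H C (by omega)) h' ?_ h1 h2
    · have := hl (i + 1) (by simpa using hi)
      simpa [Nat.add_assoc, Nat.add_comm 1 i] using this
    · intro i hi
      rcases Nat.lt_succ_iff_lt_or_eq.1 hi with hi | rfl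
      · rw [Function.update_of_ne (by omega), hg i hi]
      · rw [Function.update_self]

theorem solve_sound (hB : Basic G) (hG : NoComparable G) {crit : Bool}
    (hcrit : crit = true → Critical G) {Q : Prop}
    (hQ : crit = false → ContainsInduced G ClebschGraph → Q) {l : List ℕ} {x : ℕ}
    (h : solve crit l x = true)
    {f : ℕ → V} (hl : ∀ (i : ℕ) (hi : i < l.length), IsType G f i l[i] (f i))
    (hf : ∀ i < l.length, ∀ j < l.length, f i = f j → i = j)
    (hx : ∀ v, Outside f l.length v → ¬ IsType G f l.length x v) : Q := by
  refine build_sound hB (f := f) (m := 0) (g := f) (by simpa using hl) (by simpa using hf) ?_ h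
    (by simp) ⟨by simp, by simp⟩ fun v _ => ⟨0, by simp, fun i => by simp⟩
  intro n H C hn h g hg hM hC
  rw [Nat.zero_add] at hn
  subst hn
  refine run_sound hB hG hcrit hQ 20 _ _ _ h g hM fun v hv => ?_
  obtain ⟨t, ht, htv⟩ := hC v hv
  refine ⟨t, mem_filter.2 ⟨ht, ?_⟩, htv⟩
  rw [select_eq, if_neg]
  rw [beq_eq]
  rintro rfl
  refine hx v (fun i hi => ?_) fun i => (htv i).trans (and_congr_right fun hi => by rw [hg i hi])
  rw [← hg i hi]
  exact hv i hi

end Run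
section OddCycle

variable {V : Type*} {G : SimpleGraph V}

theorem colorable_of_forall {n : ℕ} (c : V → Fin n) (h : ∀ a b, G.Adj a b → c a ≠ c b) :
    G.Colorable n :=
  ⟨SimpleGraph.Coloring.mk c fun {a b} => h a b⟩

/-- `x 0, …, x n` is a closed walk in `R`. -/
structure ClosedWalk (G : SimpleGraph V) (R : Set V) (n : ℕ) (x : ℕ → V) : Prop where
  adj : ∀ i < n, G.Adj (x i) (x (i + 1))
  closed : x n = x 0
  mem : ∀ i ≤ n, x i ∈ R

theorem exists_odd_closedWalk {R : Set V} (h : ¬ (G.induce R).Colorable 2) :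
    ∃ n x, Odd n ∧ ClosedWalk G R n x := by
  rw [SimpleGraph.two_colorable_iff_forall_loop_even] at h
  push Not at h
  obtain ⟨u, p, hp⟩ := h
  refine ⟨p.length, fun i => p.getVert i, Nat.not_even_iff_odd.1 hp, fun i hi => ?_, by simp,
    fun i _ => (p.getVert i).2⟩
  exact p.adj_getVert_succ hi

/-- `x 0, …, x (n - 1)` is an induced cycle. -/
structure InducedCycle (G : SimpleGraph V) (n : ℕ) (x : ℕ → V) : Prop where
  inj : ∀ i < n, ∀ j < n, x i = x j → i = j
  adj : ∀ i < n, ∀ j < i, (G.Adj (x i) (x j) ↔ i = j + 1 ∨ j = 0 ∧ i = n - 1)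

theorem exists_odd_inducedCycle {R : Set V} (h : ¬ (G.induce R).Colorable 2) :
    ∃ n x, Odd n ∧ n ≠ 1 ∧ (∀ i < n, x i ∈ R) ∧ InducedCycle G n x := by
  classical
  have hex : ∃ n, Odd n ∧ ∃ x, ClosedWalk G R n x := by
    obtain ⟨n, x, h⟩ := exists_odd_closedWalk h
    exact ⟨n, h.1, x, h.2⟩
  obtain ⟨hodd, x, hx⟩ := Nat.find_spec hex
  have hmin : ∀ k < Nat.find hex, Odd k → ∀ y, ¬ ClosedWalk G R k y := fun k hk h1 y h2 =>
    Nat.find_min hex hk ⟨h1, y, h2⟩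
  generalize Nat.find hex = n at *
  have hne : ∀ j < n, ∀ i < j, x i ≠ x j := by
    intro j hj i hij h
    rcases Nat.even_or_odd (j - i) with he | ho
    · refine hmin (n - (j - i)) (by omega) (Nat.Odd.sub_even (by omega) hodd he)
        (fun k => if k ≤ i then x k else x (k + (j - i))) ⟨fun k hk => ?_, ?_, fun k hk => ?_⟩
      · rcases lt_trichotomy k i with hki | rfl | hki
        · simpa [hki.le, Nat.succ_le_iff.2 hki] using hx.adj k (by omega)
        · have := hx.adj j hj
          rw [← h] at this
          simpa [show k + 1 + (j - k) = j + 1 by omega] using this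
        · have := hx.adj (k + (j - i)) (by omega)
          simpa [show ¬ k ≤ i by omega, show ¬ k + 1 ≤ i by omega,
            show k + 1 + (j - i) = k + (j - i) + 1 by omega] using this
      · simpa [show ¬ n - (j - i) ≤ i by omega, show n - (j - i) + (j - i) = n by omega] using
          hx.closed
      · split_ifs
        · exact hx.mem _ (by omega)
        · exact hx.mem _ (by omega)
    · refine hmin (j - i) (by omega) ho (fun k => x (i + k)) ⟨fun k hk => ?_, ?_, fun k hk => ?_⟩
      · exact hx.adj (i + k) (by omega)
      · simpa [show i + (j - i) = j by omega] using h.symm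
      · exact hx.mem _ (by omega)
  have hchord : ∀ j < n, ∀ i < j, G.Adj (x i) (x j) → i + 1 < j → j < i + (n - 1) → False := by
    intro j hj i hij h h1 h2
    rcases Nat.even_or_odd (j - i) with he | ho
    · refine hmin (j - i + 1) (by omega) he.add_one
        (fun k => if k ≤ j - i then x (i + k) else x i) ⟨fun k hk => ?_, ?_, fun k hk => ?_⟩
      · rcases Nat.lt_succ_iff_lt_or_eq.1 hk with hk | rfl
        · have := hx.adj (i + k) (by omega)
          simpa [hk.le, Nat.succ_le_iff.2 hk, Nat.add_assoc] using this
        · simpa [show i + (j - i) = j by omega] using h.symm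
      · simp
      · split_ifs
        · exact hx.mem _ (by omega)
        · exact hx.mem _ (by omega)
    · refine hmin (n - (j - i - 1)) (by omega)
        (Nat.Odd.sub_even (by omega) hodd (Nat.Odd.sub_odd ho odd_one))
        (fun k => if k ≤ i then x k else x (k + (j - i - 1)))
        ⟨fun k hk => ?_, ?_, fun k hk => ?_⟩
      · rcases lt_trichotomy k i with hki | rfl | hki
        · simpa [hki.le, Nat.succ_le_iff.2 hki] using hx.adj k (by omega)
        · simpa [show k + 1 + (j - k - 1) = j by omega] using h
        · have := hx.adj (k + (j - i - 1)) (by omega)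
          simpa [show ¬ k ≤ i by omega, show ¬ k + 1 ≤ i by omega,
            show k + 1 + (j - i - 1) = k + (j - i - 1) + 1 by omega] using this
      · simpa [show ¬ n - (j - i - 1) ≤ i by omega,
          show n - (j - i - 1) + (j - i - 1) = n by omega] using hx.closed
      · split_ifs
        · exact hx.mem _ (by omega)
        · exact hx.mem _ (by omega)
  refine ⟨n, x, hodd, ?_, fun i hi => hx.mem i hi.le, fun i hi j hj h => ?_,
    fun i hi j hj => ⟨?_, ?_⟩⟩
  · rintro rfl
    exact (hx.adj 0 one_pos).ne hx.closed.symm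
  · rcases lt_trichotomy i j with hij | hij | hij
    · exact absurd h (hne j hj i hij)
    · exact hij
    · exact absurd h.symm (hne i hi j hij)
  · intro h
    by_contra hc
    exact hchord i hi j hj h.symm (by omega) (by omega)
  · rintro (rfl | ⟨rfl, rfl⟩)
    · exact (hx.adj j (by omega)).symm
    · have := hx.adj (n - 1) (by omega)
      rwa [Nat.sub_add_cancel (by omega), hx.closed] at this

theorem InducedCycle.length_eq (hB : Basic G) {n : ℕ} (hodd : Odd n) {x : ℕ → V}
    (hx : InducedCycle G n x) (h1 : n ≠ 1) : n = 5 ∨ n = 7 := by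
  obtain ⟨k, rfl⟩ := hodd
  by_contra! hn
  rcases Nat.lt_or_ge k 2 with hk | hk
  · obtain rfl : k = 1 := by omega
    exact hB.triangle ((hx.adj 1 (by omega) 0 (by omega)).2 (by omega)).symm
      ((hx.adj 2 (by omega) 1 (by omega)).2 (by omega)).symm
      ((hx.adj 2 (by omega) 0 (by omega)).2 (by omega))
  · have hk : 4 ≤ k := by omega
    have hadj : ∀ i, i + 1 < 9 → G.Adj (x i) (x (i + 1)) := fun i hi =>
      ((hx.adj (i + 1) (by omega) i (by omega)).2 (by omega)).symm
    have hnot : ∀ i j, i + 1 < j → j < i + 8 → j < 9 → ¬ G.Adj (x i) (x j) := fun i j h1 h2 h3 h =>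
      absurd ((hx.adj j (by omega) i (by omega)).1 h.symm) (by omega)
    refine hB.path (hadj 0 (by omega)) (hadj 3 (by omega)) (hadj 4 (by omega)) (hadj 5 (by omega))
      (hnot 3 6 (by omega) (by omega) (by omega)) ?_
    simp [hnot]

/-- In a triangle-free graph that is not 3-colourable and has no induced `P2 ∪ P4`, the
non-neighbours of every vertex contain an induced cycle of length 5 or 7. -/
theorem exists_inducedCycle (hB : Basic G) (hG : ¬ G.Colorable 3) (d : V) :
    ∃ n x, (n = 5 ∨ n = 7) ∧ (∀ i < n, x i ≠ d ∧ ¬ G.Adj d (x i)) ∧ InducedCycle G n x := by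
  classical
  have h2 : ¬ (G.induce {v | v ≠ d ∧ ¬ G.Adj d v}).Colorable 2 := by
    rintro ⟨c⟩
    refine hG (colorable_of_forall (fun v => if h : v ≠ d ∧ ¬ G.Adj d v then
      (c ⟨v, h⟩).castSucc else if v = d then 0 else 2) fun a b hab => ?_)
    have hlast : ∀ i : Fin 2, i.castSucc ≠ 2 := by decide
    have hc : ∀ ha hb, (c ⟨a, ha⟩).castSucc ≠ (c ⟨b, hb⟩).castSucc := fun ha hb h =>
      c.valid (v := ⟨a, ha⟩) (w := ⟨b, hb⟩) hab (Fin.castSucc_injective _ h)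
    by_cases ha : a = d
    · subst ha
      simp [hab, hab.ne.symm]
    by_cases hb : b = d
    · subst hb
      simp [hab.symm, hab.ne]
    by_cases hda : G.Adj d a <;> by_cases hdb : G.Adj d b
    · exact (hB.triangle hda hab hdb.symm).elim
    · simpa [ha, hb, hda, hdb] using (hlast _).symm
    · simpa [ha, hb, hda, hdb] using hlast _
    · simpa [ha, hb, hda, hdb] using hc ⟨ha, hda⟩ ⟨hb, hdb⟩
  obtain ⟨n, x, hodd, h1, hx, hc⟩ := exists_odd_inducedCycle h2
  exact ⟨n, x, hc.length_eq hB hodd h1, hx, hc⟩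

end OddCycle
section Prism

variable {V : Type*} {G : SimpleGraph V}

theorem containsInduced_of_injective {α : Type*} {H : SimpleGraph α} {f : α → V}
    (hf : Function.Injective f) (h : ∀ a b, G.Adj (f a) (f b) ↔ H.Adj a b) :
    ContainsInduced H G :=
  ⟨⟨f, hf⟩, h⟩

theorem adj_of_not_diamond (h : ¬ ContainsInduced DiamondGraph G) {a b p q : V}
    (hab : G.Adj a b) (hap : G.Adj a p) (hbp : G.Adj b p) (haq : G.Adj a q) (hbq : G.Adj b q)
    (hpq : p ≠ q) : G.Adj p q := by
  by_contra hn
  refine h (containsInduced_of_injective (f := ![a, b, p, q]) ?_ ?_)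
  · have := hab.ne; have := hap.ne; have := hbp.ne; have := haq.ne; have := hbq.ne
    intro i j hij
    fin_cases i <;> fin_cases j <;> simp_all
  · intro i j
    have hn' : ¬ G.Adj q p := fun h => hn h.symm
    fin_cases i <;> fin_cases j <;>
      simp [DiamondGraph, hab, hap, hbp, haq, hbq, hn, hn', hab.symm, hap.symm, hbp.symm,
        haq.symm, hbq.symm]

theorem adj_of_not_bull (h : ¬ ContainsInduced BullGraph G) {a b c p q : V}
    (hab : G.Adj a b) (hac : G.Adj a c) (hbc : G.Adj b c) (hap : G.Adj a p) (hbq : G.Adj b q)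
    (hbp : ¬ G.Adj b p) (hcp : ¬ G.Adj c p) (haq : ¬ G.Adj a q) (hcq : ¬ G.Adj c q) :
    G.Adj p q := by
  by_contra hn
  have hpq : p ≠ q := by rintro rfl; exact hbp hbq
  have hpb : b ≠ p := by rintro rfl; exact hcp hbc.symm
  have hpc : c ≠ p := by rintro rfl; exact hbp hbc
  have hqa : a ≠ q := by rintro rfl; exact hcq hac.symm
  have hqc : c ≠ q := by rintro rfl; exact haq hac
  have hs : ∀ {x y}, ¬ G.Adj x y → ¬ G.Adj y x := fun h h' => h h'.symm
  refine h (containsInduced_of_injective (f := ![a, b, c, p, q]) ?_ ?_)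
  · have := hab.ne; have := hap.ne; have := hac.ne; have := hbc.ne; have := hbq.ne
    intro i j hij
    fin_cases i <;> fin_cases j <;> simp_all
  · intro i j
    fin_cases i <;> fin_cases j <;>
      simp [BullGraph, hab, hap, hac, hbc, hbq, hn, hs hn, hab.symm, hap.symm, hac.symm,
        hbc.symm, hbq.symm, hbp, hcp, haq, hcq, hs hbp, hs hcp, hs haq, hs hcq]

variable [Fintype V]

theorem eq_of_adj_clique (hD : ¬ ContainsInduced DiamondGraph G) {K : Finset V}
    (hK : G.IsNClique G.cliqueNum K) {v a b : V} (hv : v ∉ K) (ha : a ∈ K) (hb : b ∈ K)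
    (hav : G.Adj a v) (hbv : G.Adj b v) : a = b := by
  classical
  by_contra hab
  have hadj : ∀ c ∈ K, G.Adj v c := by
    intro c hc
    by_cases hca : c = a
    · exact hca ▸ hav.symm
    by_cases hcb : c = b
    · exact hcb ▸ hbv.symm
    exact adj_of_not_diamond hD (hK.1 ha hb hab) hav hbv (hK.1 ha hc (Ne.symm hca))
      (hK.1 hb hc (Ne.symm hcb)) (by rintro rfl; exact hv hc)
  have := (hK.insert hadj)
  have := this.card_eq ▸ this.isClique.card_le_cliqueNum
  omega

theorem exists_pendant_matching [DecidableRel G.Adj] (hB : ¬ ContainsInduced BullGraph G)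
    (hD : ¬ ContainsInduced DiamondGraph G) (hn : 3 ≤ G.cliqueNum)
    (hdeg : G.cliqueNum ≤ G.minDegree) {K : Finset V} (hK : G.IsNClique G.cliqueNum K) :
    ∃ m : V → V, (∀ a ∈ K, m a ∉ K ∧ G.Adj a (m a) ∧ ∀ p ∉ K, G.Adj a p → p = m a) ∧
      ∀ a ∈ K, ∀ b ∈ K, a ≠ b → G.Adj (m a) (m b) := by
  classical
  have hex : ∀ a, ∃ p, a ∈ K → p ∉ K ∧ G.Adj a p := by
    intro a
    by_cases ha : a ∈ K
    · by_contra! hcon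
      have hsub : G.neighborFinset a ⊆ K.erase a := by
        intro p hp
        rw [G.mem_neighborFinset] at hp
        refine Finset.mem_erase.2 ⟨hp.ne.symm, ?_⟩
        by_contra hpK
        exact (hcon p).2 hpK hp
      have h1 := Finset.card_le_card hsub
      rw [G.card_neighborFinset_eq_degree, Finset.card_erase_of_mem ha, hK.card_eq] at h1
      have := G.minDegree_le_degree a
      omega
    · exact ⟨a, fun h => absurd h ha⟩
  have hthird : ∀ a b, ∃ c ∈ K, c ≠ a ∧ c ≠ b := by
    intro a b
    by_contra! hcon
    have : K ⊆ {a, b} := fun c hc => by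
      by_cases hca : c = a
      · simp [hca]
      · simp [hcon c hc hca]
    have := (Finset.card_le_card this).trans Finset.card_le_two
    rw [hK.card_eq] at this
    omega
  choose m hm using hex
  have hcomp : ∀ {a b p q}, a ∈ K → b ∈ K → a ≠ b → p ∉ K → q ∉ K → G.Adj a p → G.Adj b q →
      G.Adj p q := by
    intro a b p q ha hb hab hp hq hap hbq
    obtain ⟨c, hc, hca, hcb⟩ := hthird a b
    refine adj_of_not_bull hB (hK.1 ha hb hab) (hK.1 ha hc hca.symm) (hK.1 hb hc hcb.symm) hap hbq
      (fun h => ?_) (fun h => ?_) (fun h => ?_) fun h => ?_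
    · exact hab (eq_of_adj_clique hD hK hp ha hb hap h)
    · exact hca (eq_of_adj_clique hD hK hp hc ha h hap)
    · exact hab (eq_of_adj_clique hD hK hq ha hb h hbq)
    · exact hcb (eq_of_adj_clique hD hK hq hc hb h hbq)
  refine ⟨m, fun a ha => ⟨(hm a ha).1, (hm a ha).2, fun p hp hap => ?_⟩, fun a ha b hb hab =>
    hcomp ha hb hab (hm a ha).1 (hm b hb).1 (hm a ha).2 (hm b hb).2⟩
  by_contra hne
  obtain ⟨b, hb, hba, -⟩ := hthird a a
  obtain ⟨c, hc, hca, hcb⟩ := hthird a b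
  obtain ⟨hbm, hbb⟩ := hm b hb
  obtain ⟨hcm, hcc⟩ := hm c hc
  obtain ⟨ham, haa⟩ := hm a ha
  have hbp := hcomp hb ha hba hbm hp hbb hap
  have hpa := adj_of_not_diamond hD (hcomp hb hc hcb.symm hbm hcm hbb hcc) hbp
    (hcomp hc ha hca hcm hp hcc hap) (hcomp hb ha hba hbm ham hbb haa)
    (hcomp hc ha hca hcm ham hcc haa) hne
  have hab := adj_of_not_diamond hD hpa hap.symm haa.symm hbp.symm
    (hcomp hb ha hba hbm ham hbb haa).symm (by rintro rfl; exact hbm ha)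
  exact hba (eq_of_adj_clique hD hK hbm hb ha hbb hab)

theorem nonempty_iso_prism [DecidableRel G.Adj] (hG : G.Connected)
    (hB : ¬ ContainsInduced BullGraph G) (hD : ¬ ContainsInduced DiamondGraph G)
    (hn : 3 ≤ G.cliqueNum) (hdeg : G.cliqueNum ≤ G.minDegree) :
    Nonempty (G ≃g ((⊤ : SimpleGraph (Fin 2)) □ (⊤ : SimpleGraph (Fin G.cliqueNum)))) := by
  classical
  obtain ⟨K, hK⟩ := G.exists_isNClique_cliqueNum
  obtain ⟨m, hm, hmm⟩ := exists_pendant_matching hB hD hn hdeg hK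
  have hinj : ∀ a ∈ K, ∀ b ∈ K, m a = m b → a = b := fun a ha b hb h =>
    by_contra fun hab => (hmm a ha b hb hab).ne h
  have hL : G.IsNClique G.cliqueNum (K.image m) := by
    refine ⟨?_, by rw [Finset.card_image_of_injOn hinj, hK.card_eq]⟩
    intro p hp q hq hpq
    obtain ⟨a, ha, rfl⟩ := Finset.mem_image.1 hp
    obtain ⟨b, hb, rfl⟩ := Finset.mem_image.1 hq
    exact hmm a ha b hb (by rintro rfl; exact hpq rfl)
  have hKL : ∀ a ∈ K, a ∉ K.image m := by
    intro a ha h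
    obtain ⟨b, hb, rfl⟩ := Finset.mem_image.1 h
    exact (hm b hb).1 ha
  obtain ⟨m', hm', -⟩ := exists_pendant_matching hB hD hn hdeg hL
  have hback : ∀ a ∈ K, ∀ p ∉ K.image m, G.Adj (m a) p → p = a := by
    intro a ha p hp hap
    have h := (hm' (m a) (Finset.mem_image_of_mem m ha)).2.2
    rw [h p hp hap, ← h a (hKL a ha) (hm a ha).2.1.symm]
  have hcover : ∀ v, v ∈ K ∨ v ∈ K.image m := by
    obtain ⟨a, ha⟩ : K.Nonempty := Finset.card_pos.1 (by rw [hK.card_eq]; omega)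
    intro v
    obtain ⟨w⟩ := hG.preconnected v a
    induction w with
    | nil => exact Or.inl ha
    | @cons u v w huv _ ih =>
      rcases ih ha with hv | hv
      · by_cases hu : u ∈ K
        · exact Or.inl hu
        · rw [(hm v hv).2.2 u hu huv.symm]
          exact Or.inr (Finset.mem_image_of_mem m hv)
      · by_cases hu : u ∈ K.image m
        · exact Or.inr hu
        · obtain ⟨a, ha, rfl⟩ := Finset.mem_image.1 hv
          rw [hback a ha u hu huv.symm]
          exact Or.inl ha
  let k := K.equivFinOfCardEq hK.card_eq
  let g : Fin 2 × Fin G.cliqueNum → V := fun x =>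
    if x.1 = 0 then (k.symm x.2 : V) else m (k.symm x.2)
  have hg : Function.Bijective g := by
    constructor
    · rintro ⟨i, x⟩ ⟨j, y⟩ h
      have hx := (k.symm x).2
      have hy := (k.symm y).2
      have hxy : (k.symm x : V) ≠ m (k.symm y) := fun h =>
        hKL _ hx (h ▸ Finset.mem_image_of_mem m hy)
      have hyx : (k.symm y : V) ≠ m (k.symm x) := fun h =>
        hKL _ hy (h ▸ Finset.mem_image_of_mem m hx)
      fin_cases i <;> fin_cases j <;> simp only [g] at h
      · simpa using h
      · exact absurd h hxy
      · exact absurd h.symm hyx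
      · simpa using hinj _ hx _ hy (by simpa using h)
    · intro v
      rcases hcover v with hv | hv
      · exact ⟨(0, k ⟨v, hv⟩), by simp [g]⟩
      · obtain ⟨a, ha, rfl⟩ := Finset.mem_image.1 hv
        exact ⟨(1, k ⟨a, ha⟩), by simp [g]⟩
  refine ⟨(RelIso.symm ⟨Equiv.ofBijective g hg, ?_⟩)⟩
  have hcross : ∀ x y, G.Adj (k.symm x : V) (m (k.symm y)) ↔ x = y := by
    refine fun x y => ⟨fun h => ?_, ?_⟩
    · have := hback _ (k.symm y).2 _ (hKL _ (k.symm x).2) h.symm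
      simpa using this
    · rintro rfl
      exact (hm _ (k.symm x).2).2.1
  rintro ⟨i, x⟩ ⟨j, y⟩
  have hx := (k.symm x).2
  have hy := (k.symm y).2
  have h0 : G.Adj (k.symm x : V) (k.symm y) ↔ x ≠ y := by
    refine ⟨fun h => ?_, fun h => hK.1 hx hy (by simpa using h)⟩
    rintro rfl
    exact G.irrefl h
  have h1 : G.Adj (m (k.symm x)) (m (k.symm y)) ↔ x ≠ y := by
    refine ⟨fun h => ?_, fun h => hmm _ hx _ hy (by simpa using h)⟩
    rintro rfl
    exact G.irrefl h
  fin_cases i <;> fin_cases j <;>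
    simp [g, SimpleGraph.boxProd_adj, h0, h1, hcross, G.adj_comm (m _), eq_comm]

end Prism
section Triangle

variable {V : Type*} {G : SimpleGraph V}

theorem basic_of_cliqueFree (h3 : G.CliqueFree 3) (hP : ¬ ContainsInduced P2UnionP4 G) :
    Basic G := by
  classical
  have htri : ∀ {a b c}, G.Adj a b → G.Adj b c → G.Adj c a → False := fun h1 h2 h3' =>
    h3 _ (SimpleGraph.is3Clique_triple_iff.2 ⟨h1, h3'.symm, h2⟩)
  refine ⟨htri, fun {a b p q r s} hab hpq hqr hrs hps h => hP ?_⟩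
  simp only [List.forall_mem_cons, List.not_mem_nil, false_implies, implies_true, and_true] at h
  obtain ⟨⟨hap, hbp⟩, ⟨haq, hbq⟩, ⟨har, hbr⟩, has, hbs⟩ := h
  have hpr : ¬ G.Adj p r := fun h => htri hpq hqr h.symm
  have hqs : ¬ G.Adj q s := fun h => htri hqr hrs h.symm
  have hs : ∀ {x y}, ¬ G.Adj x y → ¬ G.Adj y x := fun h h' => h h'.symm
  have hne : ∀ {x y z : V}, G.Adj x z → ¬ G.Adj y z → x ≠ y := by
    rintro x y z h h' rfl
    exact h' h
  have hps' : p ≠ s := by rintro rfl; exact hpr hrs.symm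
  have hpr' : p ≠ r := by rintro rfl; exact hps hrs
  have hqs' : q ≠ s := by rintro rfl; exact hps hpq
  have hnodup : (List.ofFn ![a, b, p, q, r, s]).Nodup := by
    simp [List.ofFn_succ, hab.ne, hpq.ne, hqr.ne, hrs.ne, hps', hne hab (hs hbp), hne hab (hs hbq),
      hne hab (hs hbr), hne hab (hs hbs), hne hab.symm (hs hap), hne hab.symm (hs haq),
      hne hab.symm (hs har), hne hab.symm (hs has), hpr', hqs']
  refine containsInduced_of_injective (f := ![a, b, p, q, r, s]) (List.nodup_ofFn.1 hnodup)
    fun i j => ?_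
  fin_cases i <;> fin_cases j <;>
    simp [P2UnionP4, hab, hab.symm, hpq, hpq.symm, hqr, hqr.symm, hrs, hrs.symm, hps, hs hps,
      hpr, hs hpr, hqs, hs hqs, hap, hbp, haq, hbq, har, hbr, has, hbs, hs hap, hs hbp, hs haq,
      hs hbq, hs har, hs hbr, hs has, hs hbs]

theorem solve_cycle_seven :
    solve true [0, 1, 2, 4, 8, 16, 33, 0] 1000000 = true := by decide +kernel

theorem solve_cycle_five :
    solve true [0, 1, 2, 4, 9, 0] 42 = true := by decide +kernel

theorem solve_groetzsch :
    solve false [0, 1, 2, 4, 9, 0, 37, 42, 52, 41, 50] 1000000 = true := by decide +kernel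

theorem isType_of_lt {f : ℕ → V} {n t : ℕ} {v : V} (ht : t < 2 ^ n)
    (h : ∀ i < n, (t.testBit i = true ↔ G.Adj v (f i))) : IsType G f n t v := by
  intro i
  by_cases hi : i < n
  · simp [hi, h i hi]
  · rw [Nat.testBit_lt_two_pow (ht.trans_le (Nat.pow_le_pow_right two_pos (not_lt.1 hi)))]
    simp [hi]

/-- The cycle `x` together with the isolated vertex `d` realises the codes `l`. -/
theorem InducedCycle.isType {n : ℕ} {x : ℕ → V} (hx : InducedCycle G n x) {d : V}
    (hd : ∀ i < n, x i ≠ d ∧ ¬ G.Adj d (x i)) {l : List ℕ} (hl : l.length = n + 1)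
    (hcode : ∀ i (hi : i < l.length), l[i] < 2 ^ i ∧ ∀ j < i,
      (l[i].testBit j = true ↔ i < n ∧ (i = j + 1 ∨ j = 0 ∧ i = n - 1))) :
    (∀ i (hi : i < l.length), IsType G (Function.update x n d) i l[i] (Function.update x n d i)) ∧
    ∀ i < l.length, ∀ j < l.length,
      Function.update x n d i = Function.update x n d j → i = j := by
  have hu : ∀ i < n, Function.update x n d i = x i := fun i hi =>
    Function.update_of_ne (by omega) _ _
  have hu' : Function.update x n d n = d := Function.update_self ..
  refine ⟨fun i hi' => isType_of_lt (hcode i hi').1 fun j hj => ?_, fun i hi j hj h => ?_⟩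
  · rw [(hcode i hi').2 j hj, hu j (by omega)]
    rcases Nat.lt_succ_iff_lt_or_eq.1 (hi'.trans_eq hl) with hi | rfl
    · rw [hu i hi, hx.adj i hi j hj]
      simp [hi]
    · rw [hu']
      simp [(hd j hj).2]
  · rcases Nat.lt_succ_iff_lt_or_eq.1 (hi.trans_eq hl) with hi | rfl <;>
    rcases Nat.lt_succ_iff_lt_or_eq.1 (hj.trans_eq hl) with hj | rfl
    · rw [hu i hi, hu j hj] at h
      exact hx.inj i hi j hj h
    · rw [hu i hi, hu'] at h
      exact absurd h (hd i hi).1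
    · rw [hu j hj, hu'] at h
      exact absurd h.symm (hd j hj).1
    · rfl

theorem InducedCycle.rotate {x : ℕ → V} (hx : InducedCycle G 5 x) (s : ℕ) :
    InducedCycle G 5 fun i => x ((i + s) % 5) := by
  refine ⟨fun i hi j hj h => ?_, fun i hi j hj => ?_⟩
  · have := hx.inj _ (Nat.mod_lt _ (by omega)) _ (Nat.mod_lt _ (by omega)) h
    omega
  · have h1 : (i + s) % 5 < 5 := Nat.mod_lt _ (by omega)
    have h2 : (j + s) % 5 < 5 := Nat.mod_lt _ (by omega)
    rcases lt_trichotomy ((i + s) % 5) ((j + s) % 5) with h | h | h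
    · rw [G.adj_comm, hx.adj _ h2 _ h]
      omega
    · omega
    · rw [hx.adj _ h1 _ h]
      omega

theorem not_outside_isType {f : ℕ → V} {n t i : ℕ} (hn : n ≤ i) (ht : t.testBit i = true) (v : V)
    : ¬ IsType G f n t v := fun h => absurd ((h i).1 ht).1 (by omega)

theorem Critical.false_of_noComparable (hc : Critical G) (hB : Basic G) (hG : NoComparable G)
    (d : V) : False := by
  obtain ⟨n, x, hn, hd, hx⟩ := exists_inducedCycle hB hc.coloring d
  rcases hn with rfl | rfl
  · obtain ⟨s, hmiss⟩ : ∃ s, ∀ w, ¬ (G.Adj d w ∧ G.Adj w (x ((1 + s) % 5)) ∧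
        G.Adj w (x ((3 + s) % 5))) := by
      by_contra! hcon
      obtain ⟨w₁, h₁⟩ := hcon 4
      obtain ⟨w₂, h₂⟩ := hcon 0
      obtain ⟨w₃, h₃⟩ := hcon 1
      obtain ⟨w₄, h₄⟩ := hcon 2
      obtain ⟨w₅, h₅⟩ := hcon 3
      have hadj : ∀ i < 4, G.Adj (x i) (x (i + 1)) := fun i hi =>
        ((hx.adj (i + 1) (by omega) i (by omega)).2 (by omega)).symm
      exact hc.groetzsch (containsInduced_groetzsch_of_adj hB ⟨⟨h₁.1, h₂.1, h₃.1, h₄.1, h₅.1⟩,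
        ⟨hadj 0 (by omega), hadj 1 (by omega), hadj 2 (by omega), hadj 3 (by omega),
          ((hx.adj 4 (by omega) 0 (by omega)).2 (by omega)).symm⟩,
        ⟨h₁.2.1, h₂.2.1, h₃.2.1, h₄.2.1, h₅.2.1⟩, ⟨h₁.2.2, h₂.2.2, h₃.2.2, h₄.2.2, h₅.2.2⟩⟩)
    have hx' := hx.rotate s
    obtain ⟨hl, hf⟩ := hx'.isType (d := d) (fun i hi => hd _ (Nat.mod_lt _ (by omega)))
      (l := [0, 1, 2, 4, 9, 0]) rfl (by decide)
    refine solve_sound hB hG (fun _ => hc) (fun h => by cases h) solve_cycle_five hl hf ?_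
    intro v _ hv
    have h1 := ((hv 1).1 (by decide)).2
    have h3 := ((hv 3).1 (by decide)).2
    have h5 := ((hv 5).1 (by decide)).2
    exact hmiss v ⟨by simpa using h5.symm, by simpa using h1, by simpa using h3⟩
  · obtain ⟨hl, hf⟩ := hx.isType hd (l := [0, 1, 2, 4, 8, 16, 33, 0]) rfl (by decide)
    exact solve_sound hB hG (fun _ => hc) (fun h => by cases h) solve_cycle_seven hl hf
      fun v _ => not_outside_isType (i := 19) (by simp) (by decide) v

/-- Every vertex-critical graph that is not 3-colourable has no comparable pair. -/
theorem noComparable_of_critical (hG : ¬ G.Colorable 3)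
    (hc : ∀ v, ∃ c : V → Fin 3, ∀ a b, a ≠ v → b ≠ v → G.Adj a b → c a ≠ c b) :
    NoComparable G := by
  classical
  intro u v huv hadj
  by_contra! hcon
  obtain ⟨c, hc⟩ := hc u
  refine hG (colorable_of_forall (Function.update c u (c v)) fun a b hab => ?_)
  have hu' : Function.update c u (c v) u = c v := Function.update_self ..
  have hu : ∀ w, w ≠ u → Function.update c u (c v) w = c w := fun w hw =>
    Function.update_of_ne hw _ _
  by_cases ha : a = u
  · subst ha
    rw [hu', hu b hab.ne.symm]
    exact hc _ _ huv.symm hab.ne.symm (hcon b hab)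
  by_cases hb : b = u
  · subst hb
    rw [hu', hu a hab.ne]
    exact hc _ _ hab.ne huv.symm (hcon a hab.symm).symm
  rw [hu a ha, hu b hb]
  exact hc a b ha hb hab

theorem critical_of_forall (hG : ¬ G.Colorable 3) (hF : ¬ ContainsInduced GrotzschGraph G)
    (hc : ∀ v, ∃ c : V → Fin 3, ∀ a b, a ≠ v → b ≠ v → G.Adj a b → c a ≠ c b) :
    Critical G := by
  classical
  refine ⟨fun v x y => ?_, fun {a b x y} hab hxy hxa hxb hya hyb => ?_, hF, hG⟩
  · by_contra! hcon
    obtain ⟨c, hc⟩ := hc v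
    obtain ⟨k, hkx, hky⟩ : ∃ k, k ≠ c x ∧ k ≠ c y := by
      generalize c x = i
      generalize c y = j
      revert i j
      decide
    have hk : ∀ w, G.Adj v w → k ≠ c w := by
      intro w hw
      by_cases h : w = x
      · rwa [h]
      · rwa [hcon w hw h]
    refine hG (colorable_of_forall (Function.update c v k) fun a b hab => ?_)
    have hu' : Function.update c v k v = k := Function.update_self ..
    have hu : ∀ w, w ≠ v → Function.update c v k w = c w := fun w hw =>
      Function.update_of_ne hw _ _
    by_cases ha : a = v
    · subst ha
      rw [hu', hu b hab.ne.symm]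
      exact hk b hab
    by_cases hb : b = v
    · subst hb
      rw [hu', hu a hab.ne]
      exact (hk a hab.symm).symm
    rw [hu a ha, hu b hb]
    exact hc a b ha hb hab
  · by_contra! hcon
    obtain ⟨c, hc⟩ := hc a
    let g : V → Fin 3 := fun w => if w = a then c x else if w = b then c y else c w
    have hga : g a = c x := if_pos rfl
    have hgb : g b = c y := by simp [g, hab.ne.symm]
    have hg : ∀ w, w ≠ a → w ≠ b → g w = c w := fun w h1 h2 => by simp [g, h1, h2]
    have ha : ∀ w, G.Adj a w → g a ≠ g w := by
      intro w hw
      by_cases hwb : w = b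
      · subst hwb
        rw [hga, hgb]
        exact hc x y hxa hya hxy
      · rw [hga, hg w hw.ne.symm hwb]
        exact hc x w hxa hw.ne.symm ((hcon w).1 hw hwb)
    have hb : ∀ w, G.Adj b w → g b ≠ g w := by
      intro w hw
      by_cases hwa : w = a
      · subst hwa
        exact (ha b hab).symm
      · rw [hgb, hg w hwa hw.ne.symm]
        exact hc y w hya hwa ((hcon w).2 hw hwa)
    refine hG (colorable_of_forall g fun v w hvw => ?_)
    by_cases hva : v = a
    · exact hva ▸ ha w (hva ▸ hvw)
    by_cases hvb : v = b
    · exact hvb ▸ hb w (hvb ▸ hvw)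
    by_cases hwa : w = a
    · exact hwa ▸ (ha v (hwa ▸ hvw.symm)).symm
    by_cases hwb : w = b
    · exact hwb ▸ (hb v (hwb ▸ hvw.symm)).symm
    rw [hg v hva hvb, hg w hwa hwb]
    exact hc v w hva hwa hvw

theorem containsInduced_groetzsch_of_not_colorable {V : Type*} [Finite V] {G : SimpleGraph V}
    (hB : Basic G) (hG : ¬ G.Colorable 3) : ContainsInduced GrotzschGraph G := by
  classical
  induction hn : Nat.card V using Nat.strong_induction_on generalizing V with
  | _ n ih =>
    by_contra hF
    by_cases hcrit : ∀ v, (G.induce {w | w ≠ v}).Colorable 3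
    · have hc : ∀ v, ∃ c : V → Fin 3, ∀ a b, a ≠ v → b ≠ v → G.Adj a b → c a ≠ c b := by
        intro v
        obtain ⟨c⟩ := hcrit v
        refine ⟨fun w => if h : w ≠ v then c ⟨w, h⟩ else 0, fun a b ha hb hab => ?_⟩
        simp only [dif_pos ha, dif_pos hb]
        exact c.valid (v := ⟨a, ha⟩) (w := ⟨b, hb⟩) hab
      rcases isEmpty_or_nonempty V with hV | ⟨⟨d⟩⟩
      · exact hG (SimpleGraph.Colorable.of_isEmpty 3)
      · exact (critical_of_forall hG hF hc).false_of_noComparable hB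
          (noComparable_of_critical hG hc) d
    · push Not at hcrit
      obtain ⟨v, hv⟩ := hcrit
      have hcard : Nat.card {w | w ≠ v} < n := by
        rw [← hn]
        exact Finite.card_subtype_lt (p := fun w => w ≠ v) (x := v) (by simp)
      have hB' : Basic (G.induce {w | w ≠ v}) :=
        ⟨fun h1 h2 h3 => hB.triangle h1 h2 h3, fun h1 h2 h3 h4 h5 h6 =>
          hB.path h1 h2 h3 h4 h5 (by simpa using h6)⟩
      obtain ⟨g, hg⟩ := ih _ hcard hB' hv rfl
      exact hF ⟨g.trans (Function.Embedding.subtype _), hg⟩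

theorem containsInduced_clebsch (hB : Basic G) (hG : NoComparable G)
    (hF : ContainsInduced GrotzschGraph G) : ContainsInduced G ClebschGraph := by
  obtain ⟨g, hg⟩ := hF
  let σ : ℕ → Fin 11 := fun i => [6, 7, 8, 9, 10, 0, 1, 2, 3, 4, 5].getD i 0
  have hσ : ∀ i < 11, ∀ j < 11, σ i = σ j → i = j := by decide
  have hl : ∀ i (hi : i < [0, 1, 2, 4, 9, 0, 37, 42, 52, 41, 50].length),
      [0, 1, 2, 4, 9, 0, 37, 42, 52, 41, 50][i] < 2 ^ i ∧ ∀ j < i,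
      ([0, 1, 2, 4, 9, 0, 37, 42, 52, 41, 50][i].testBit j = true ↔
        GrotzschGraph.Adj (σ i) (σ j)) := by decide +kernel
  refine solve_sound hB hG (crit := false) (fun h => by cases h) (fun _ h => h) solve_groetzsch
    (f := fun i => g (σ i)) (fun i hi => isType_of_lt (hl i hi).1 fun j hj => ?_) ?_
    fun v _ => not_outside_isType (i := 19) (by simp) (by decide) v
  · rw [hg]
    exact (hl i hi).2 j hj
  · exact fun i hi j hj h => hσ i hi j hj (g.injective h)

theorem clebschGraph_colorable : ClebschGraph.Colorable 4 :=
  have h : ∀ x y, ClebschGraph.Adj x y →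
      (x 0 + x 1 + x 2, x 3) ≠ (y 0 + y 1 + y 2, y 3) := by decide +kernel
  (SimpleGraph.Coloring.mk (fun x => (x 0 + x 1 + x 2, x 3)) fun {x y} => h x y).colorable

theorem colorable_of_containsInduced {α : Type*} {H : SimpleGraph α} {n : ℕ}
    (h : ContainsInduced H G) (hG : G.Colorable n) : H.Colorable n := by
  obtain ⟨g, hg⟩ := h
  exact hG.of_hom (⟨g, fun {a b} hab => (hg a b).2 hab⟩ : H →g G)

end Triangle

end GraphSearch

theorem statement_13 {V : Type*} [Fintype V] (G : SimpleGraph V) [DecidableRel G.Adj]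
    (hconn : G.Connected)
    (hP : ¬ ContainsInduced P2UnionP4 G)
    (hbull : ¬ ContainsInduced BullGraph G)
    (hdiamond : ¬ ContainsInduced DiamondGraph G) :
    (∃ u v : V, u ≠ v ∧ ¬ G.Adj u v ∧ G.neighborSet u ⊆ G.neighborSet v) ∨
    G.minDegree ≤ G.cliqueNum - 1 ∨
    Nonempty (G ≃g ((⊤ : SimpleGraph (Fin 2)) □ (⊤ : SimpleGraph (Fin G.cliqueNum)))) ∨
    (ContainsInduced GrotzschGraph G ∧ ContainsInduced G ClebschGraph ∧
      G.chromaticNumber = 4) ∨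
    G.chromaticNumber ≤ 3 := by
  by_cases hcomp : ∃ u v : V, u ≠ v ∧ ¬ G.Adj u v ∧ G.neighborSet u ⊆ G.neighborSet v
  · exact Or.inl hcomp
  by_cases hdeg : G.minDegree ≤ G.cliqueNum - 1
  · exact Or.inr (Or.inl hdeg)
  refine Or.inr (Or.inr ?_)
  rcases Nat.lt_or_ge G.cliqueNum 3 with hn | hn
  · refine Or.inr (or_iff_not_imp_right.2 fun hchi => ?_)
    have hcol : ¬ G.Colorable 3 := fun h => hchi (by exact_mod_cast h.chromaticNumber_le)
    have hB : GraphSearch.Basic G := GraphSearch.basic_of_cliqueFree (fun s hs => by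
      have := hs.isClique.card_le_cliqueNum
      rw [hs.card_eq] at this
      omega) hP
    have hG : GraphSearch.NoComparable G := fun u v huv hadj => by
      by_contra! hcon
      exact hcomp ⟨u, v, huv, hadj, fun w hw => hcon w hw⟩
    have hF := GraphSearch.containsInduced_groetzsch_of_not_colorable hB hcol
    have hC := GraphSearch.containsInduced_clebsch hB hG hF
    refine ⟨hF, hC, ?_⟩
    have h4 := GraphSearch.colorable_of_containsInduced hC GraphSearch.clebschGraph_colorable
    exact_mod_cast SimpleGraph.chromaticNumber_eq_iff_colorable_not_colorable.2 ⟨h4, hcol⟩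
  · exact Or.inl (GraphSearch.nonempty_iso_prism hconn hbull hdiamond hn (by omega))
end

section
/- Every (P2∪P4, bull, diamond)-free simple graph G satisfies χ(G) ≤ max{4, ω(G)}. -/
open SimpleGraph

/-- To embed `H` as an induced subgraph it suffices to give a map that preserves and reflects
adjacency and separates twins of `H`. -/
theorem ContainsInduced.of_map {α β : Type*} [LinearOrder α] {H : SimpleGraph α}
    {G : SimpleGraph β} (f : α → β)
    (htwin : ∀ i j, i < j → (∀ k, H.Adj i k ↔ H.Adj j k) → f i ≠ f j)
    (hf : ∀ i j, i < j → (G.Adj (f i) (f j) ↔ H.Adj i j)) : ContainsInduced H G := by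
  have hf' : ∀ i j, G.Adj (f i) (f j) ↔ H.Adj i j := by
    intro i j
    rcases lt_trichotomy i j with hij | rfl | hij
    · exact hf i j hij
    · simp
    · rw [G.adj_comm, H.adj_comm, hf j i hij]
  have hlt : ∀ i j, i < j → f i ≠ f j := fun i j hij heq =>
    htwin i j hij (fun k => by rw [← hf', ← hf', heq]) heq
  refine ⟨⟨f, fun i j heq => ?_⟩, hf'⟩
  rcases lt_trichotomy i j with hij | rfl | hij
  · exact (hlt i j hij heq).elim
  · rfl
  · exact (hlt j i hij heq.symm).elim

/-- In a bull-free graph, pendant neighbours of two vertices of a triangle are adjacent. -/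
theorem SimpleGraph.adj_of_bullFree {V : Type*} {G : SimpleGraph V}
    (h : ¬ ContainsInduced BullGraph G) {a b c u w : V} (hab : G.Adj a b) (hac : G.Adj a c)
    (hbc : G.Adj b c) (hau : G.Adj a u) (hbw : G.Adj b w) (hbu : ¬ G.Adj b u)
    (hcu : ¬ G.Adj c u) (haw : ¬ G.Adj a w) (hcw : ¬ G.Adj c w) : G.Adj u w := by
  by_contra huw
  refine h (.of_map ![a, b, c, u, w] (fun i j hij => ?_) fun i j hij => ?_)
  · fin_cases i <;> fin_cases j <;>
      first
      | exact absurd hij (by decide)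
      | simp [BullGraph, Fin.forall_fin_succ, *]
  · fin_cases i <;> fin_cases j <;>
      first
      | exact absurd hij (by decide)
      | simp [BullGraph, *]

/-- In a diamond-free graph, a common neighbour of two vertices of a triangle is
adjacent to or equal to the third vertex. -/
theorem SimpleGraph.adj_of_diamondFree {V : Type*} {G : SimpleGraph V}
    (h : ¬ ContainsInduced DiamondGraph G) {a b c v : V} (hab : G.Adj a b) (hac : G.Adj a c)
    (hbc : G.Adj b c) (hav : G.Adj a v) (hbv : G.Adj b v) (hne : c ≠ v) : G.Adj c v := by
  by_contra hcv
  refine h (.of_map ![a, b, c, v] (fun i j hij => ?_) fun i j hij => ?_)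
  · fin_cases i <;> fin_cases j <;>
      first
      | exact absurd hij (by decide)
      | simp [DiamondGraph, Fin.forall_fin_succ, *]
  · fin_cases i <;> fin_cases j <;>
      first
      | exact absurd hij (by decide)
      | simp [DiamondGraph, *]

/-- In a `P2 ∪ P4`-free graph, no induced `P4` is anticomplete to an edge. -/
theorem SimpleGraph.not_inducedPath_of_P2UnionP4Free {V : Type*} {G : SimpleGraph V}
    (h : ¬ ContainsInduced P2UnionP4 G) {p q : V} (hpq : G.Adj p q) {a b c d : V}
    (hp : ∀ x ∈ [a, b, c, d], ¬ G.Adj p x ∧ ¬ G.Adj q x)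
    (hab : G.Adj a b) (hbc : G.Adj b c) (hcd : G.Adj c d)
    (hac : ¬ G.Adj a c) (hbd : ¬ G.Adj b d) : G.Adj a d := by
  by_contra had
  simp only [List.forall_mem_cons] at hp
  obtain ⟨⟨hpa, hqa⟩, ⟨hpb, hqb⟩, ⟨hpc, hqc⟩, ⟨hpd, hqd⟩, -⟩ := hp
  refine h (.of_map ![p, q, a, b, c, d] (fun i j hij => ?_) fun i j hij => ?_)
  · fin_cases i <;> fin_cases j <;>
      first
      | exact absurd hij (by decide)
      | simp [P2UnionP4, Fin.forall_fin_succ, *]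
  · fin_cases i <;> fin_cases j <;>
      first
      | exact absurd hij (by decide)
      | simp [P2UnionP4, *]

/-- A triangle-free, `P4`-free set of vertices induces a bipartite graph. -/
theorem SimpleGraph.exists_two_coloring_of_P4Free {V : Type*} {G : SimpleGraph V} (T : Finset V)
    (htri : ∀ a ∈ T, ∀ b ∈ T, ∀ c ∈ T, G.Adj a b → G.Adj b c → ¬ G.Adj a c)
    (hpath : ∀ a ∈ T, ∀ b ∈ T, ∀ c ∈ T, ∀ d ∈ T, G.Adj a b → G.Adj b c → G.Adj c d →
      ¬ G.Adj a c → ¬ G.Adj b d → G.Adj a d) :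
    ∃ col : V → Bool, ∀ x ∈ T, ∀ y ∈ T, G.Adj x y → col x ≠ col y := by
  classical
  induction T using Finset.strongInduction with
  | H T ih =>
  by_cases hedge : ∃ x ∈ T, ∃ y ∈ T, G.Adj x y
  swap
  · push Not at hedge
    exact ⟨fun _ => true, fun x hx y hy hxy => (hedge x hx y hy hxy).elim⟩
  obtain ⟨x, hx, y, hy, hxy⟩ := hedge
  obtain ⟨col, hcol⟩ := ih (T.filter fun z => ¬ G.Adj x z ∧ ¬ G.Adj y z)
    (Finset.filter_ssubset.2 ⟨x, hx, fun h => h.2 hxy.symm⟩)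
    (fun a ha b hb c hc => htri a (Finset.mem_filter.1 ha).1 b (Finset.mem_filter.1 hb).1 c
      (Finset.mem_filter.1 hc).1)
    (fun a ha b hb c hc d hd => hpath a (Finset.mem_filter.1 ha).1 b (Finset.mem_filter.1 hb).1 c
      (Finset.mem_filter.1 hc).1 d (Finset.mem_filter.1 hd).1)
  have hclosed : ∀ u ∈ T, ∀ v ∈ T, G.Adj u v → G.Adj x u ∨ G.Adj y u → G.Adj x v ∨ G.Adj y v := by
    intro u hu v hv huv hor
    by_contra! hv'
    rcases hor with h | h
    · exact hv'.2 (hpath v hv u hu x hx y hy huv.symm h.symm hxy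
        (fun h' => hv'.1 h'.symm) (fun h' => htri x hx y hy u hu hxy h'.symm h)).symm
    · exact hv'.1 (hpath v hv u hu y hy x hx huv.symm h.symm hxy.symm
        (fun h' => hv'.2 h'.symm) (fun h' => htri x hx u hu y hy h'.symm h.symm hxy)).symm
  refine ⟨fun z => if G.Adj x z then true else if G.Adj y z then false else col z, ?_⟩
  intro u hu v hv huv
  have h1 := htri x hx u hu v hv
  have h2 := htri y hy u hu v hv
  have h3 := hclosed u hu v hv huv
  have h4 := hclosed v hv u hu huv.symm
  have h5 := hcol u
  grind

/-- A triangle-free set of vertices in a `P2 ∪ P4`-free graph is 4-colorable. -/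
theorem SimpleGraph.exists_four_coloring_of_P2UnionP4Free {V : Type*} {G : SimpleGraph V}
    (hP : ¬ ContainsInduced P2UnionP4 G) (S : Finset V)
    (htri : ∀ a ∈ S, ∀ b ∈ S, ∀ c ∈ S, G.Adj a b → G.Adj b c → ¬ G.Adj a c) :
    ∃ col : V → Fin 4, ∀ x ∈ S, ∀ y ∈ S, G.Adj x y → col x ≠ col y := by
  classical
  by_cases hedge : ∃ p ∈ S, ∃ q ∈ S, G.Adj p q
  swap
  · push Not at hedge
    exact ⟨fun _ => 0, fun x hx y hy hxy => (hedge x hx y hy hxy).elim⟩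
  obtain ⟨p, hp, q, hq, hpq⟩ := hedge
  obtain ⟨col, hcol⟩ := SimpleGraph.exists_two_coloring_of_P4Free (G := G)
    (S.filter fun z => ¬ G.Adj p z ∧ ¬ G.Adj q z)
    (fun a ha b hb c hc => htri a (Finset.mem_filter.1 ha).1 b (Finset.mem_filter.1 hb).1 c
      (Finset.mem_filter.1 hc).1)
    (fun a ha b hb c hc d hd =>
      SimpleGraph.not_inducedPath_of_P2UnionP4Free hP hpq (by
        simp only [Finset.mem_filter] at ha hb hc hd
        simp [ha, hb, hc, hd]))
  refine ⟨fun z => if G.Adj p z then 0 else if G.Adj q z then 1 else if col z then 2 else 3, ?_⟩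
  intro u hu v hv huv
  have h1 := htri p hp u hu v hv
  have h2 := htri q hq u hu v hv
  have h3 := hcol u
  grind

/-- A vertex outside a maximal clique of a diamond-free graph has at most one neighbour in it. -/
theorem SimpleGraph.eq_of_adj_maximalClique {V : Type*} {G : SimpleGraph V}
    (hdiamond : ¬ ContainsInduced DiamondGraph G) {S K : Finset V}
    (hK : Maximal (fun K : Finset V => K ⊆ S ∧ G.IsClique K) K) {v a b : V} (hv : v ∈ S)
    (hvK : v ∉ K) (ha : a ∈ K) (hb : b ∈ K) (hav : G.Adj a v) (hbv : G.Adj b v) : a = b := by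
  classical
  by_contra hab
  refine hvK (hK.2 (y := insert v K) ⟨?_, ?_⟩ (Finset.subset_insert _ _)
    (Finset.mem_insert_self _ _))
  · exact Finset.insert_subset hv hK.1.1
  · rw [Finset.coe_insert]
    refine hK.1.2.insert fun c hc hvc => ?_
    have hc' : c ∈ K := hc
    rcases eq_or_ne a c with rfl | hac
    · exact hav.symm
    rcases eq_or_ne b c with rfl | hbc
    · exact hbv.symm
    exact SimpleGraph.adj_of_diamondFree hdiamond (hK.1.2 ha hb hab) (hK.1.2 ha hc hac)
      (hK.1.2 hb hc hbc) hav hbv hvc.symm |>.symm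

/-- A set of vertices in a `(P2 ∪ P4, bull, diamond)`-free graph is `k`-colorable
whenever `4 ≤ k` and all cliques have size at most `k`. -/
theorem SimpleGraph.exists_coloring_of_free {V : Type*} {G : SimpleGraph V}
    (hP : ¬ ContainsInduced P2UnionP4 G) (hbull : ¬ ContainsInduced BullGraph G)
    (hdiamond : ¬ ContainsInduced DiamondGraph G) {k : ℕ} (hk : 4 ≤ k)
    (hclique : ∀ K : Finset V, G.IsClique K → K.card ≤ k) (S : Finset V) :
    ∃ col : V → Fin k, ∀ x ∈ S, ∀ y ∈ S, G.Adj x y → col x ≠ col y := by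
  classical
  induction S using Finset.strongInduction with
  | H S ih =>
  by_cases htri : ∀ a ∈ S, ∀ b ∈ S, ∀ c ∈ S, G.Adj a b → G.Adj b c → ¬ G.Adj a c
  · obtain ⟨col, hcol⟩ := SimpleGraph.exists_four_coloring_of_P2UnionP4Free hP S htri
    exact ⟨fun x => Fin.castLE hk (col x), fun x hx y hy hxy h =>
      hcol x hx y hy hxy (Fin.castLE_injective hk h)⟩
  push Not at htri
  obtain ⟨x, hx, y, hy, z, hz, hxy, hyz, hxz⟩ := htri
  obtain ⟨K, hxyzK, hK⟩ : ∃ K, {x, y, z} ⊆ K ∧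
      Maximal (fun K : Finset V => K ⊆ S ∧ G.IsClique K) K := by
    refine Set.Finite.exists_le_maximal (s := {K : Finset V | K ⊆ S ∧ G.IsClique K})
      (S.powerset.finite_toSet.subset fun K hK =>
        Finset.mem_coe.2 (Finset.mem_powerset.2 hK.1)) ⟨?_, ?_⟩
    · simp [Finset.insert_subset_iff, hx, hy, hz]
    · simp [SimpleGraph.isClique_insert, hxy, hyz, hxz]
  have hcard : 3 ≤ K.card := by
    rw [← Finset.card_eq_three.2 ⟨x, y, z, hxy.ne, hxz.ne, hyz.ne, rfl⟩]
    exact Finset.card_le_card hxyzK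
  by_cases hpend : ∃ a ∈ K, ∀ v ∈ S, v ∉ K → ¬ G.Adj a v
  · obtain ⟨a, ha, hav⟩ := hpend
    obtain ⟨col, hcol⟩ := ih (S.erase a) (Finset.erase_ssubset (hK.1.1 ha))
    obtain ⟨i, hi⟩ : ∃ i, i ∉ (K.erase a).image col := by
      by_contra! hall
      have h1 : (Finset.univ : Finset (Fin k)).card ≤ ((K.erase a).image col).card :=
        Finset.card_le_card fun i _ => hall i
      have h2 := h1.trans Finset.card_image_le
      rw [Finset.card_erase_of_mem ha, Finset.card_fin] at h2
      have := hclique K hK.1.2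
      omega
    have hi' : ∀ v ∈ S, G.Adj a v → col v ≠ i := fun v hv hadj h =>
      hi (Finset.mem_image.2 ⟨v, Finset.mem_erase.2 ⟨hadj.ne', by
        by_contra hvK
        exact hav v hv hvK hadj⟩, h⟩)
    refine ⟨Function.update col a i, fun u hu v hv huv => ?_⟩
    have h1 := hi' u hu
    have h2 := hi' v hv
    have h3 := hcol u
    have h4 := huv.ne
    have h5 := huv.symm
    grind
  push Not at hpend
  choose! u huS huK hua using hpend
  have hone : ∀ a ∈ K, ∀ b ∈ K, ∀ v ∈ S, v ∉ K → G.Adj a v → G.Adj b v → a = b :=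
    fun a ha b hb v hv hvK => SimpleGraph.eq_of_adj_maximalClique hdiamond hK hv hvK ha hb
  have hjoin : ∀ a ∈ K, ∀ b ∈ K, a ≠ b → ∀ v ∈ S, v ∉ K → ∀ w ∈ S, w ∉ K →
      G.Adj a v → G.Adj b w → G.Adj v w := by
    intro a ha b hb hab v hv hvK w hw hwK hav hbw
    obtain ⟨c, hc, hca, hcb⟩ : ∃ c ∈ K, c ≠ a ∧ c ≠ b := by
      have : ({a, b} : Finset V).card < K.card :=
        (Finset.card_le_two).trans_lt (by omega)
      obtain ⟨c, hc, hcn⟩ := Finset.exists_mem_notMem_of_card_lt_card this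
      exact ⟨c, hc, by simpa using hcn⟩
    exact SimpleGraph.adj_of_bullFree hbull (hK.1.2 ha hb hab) (hK.1.2 ha hc hca.symm)
      (hK.1.2 hb hc hcb.symm) hav hbw
      (fun h => hab (hone a ha b hb v hv hvK hav h))
      (fun h => hca (hone a ha c hc v hv hvK hav h).symm)
      (fun h => hab (hone b hb a ha w hw hwK hbw h).symm)
      (fun h => hcb (hone b hb c hc w hw hwK hbw h).symm)
  obtain ⟨σ, hσ, -⟩ := K.countable_toSet.exists_cycleOn
  have hnt : (K : Set V).Nontrivial := Finset.one_lt_card_iff_nontrivial.1 (by omega)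
  have hσne : ∀ a ∈ K, σ a ≠ a := fun a ha => hσ.apply_ne hnt ha
  have hσK : ∀ a ∈ K, σ a ∈ K := fun a ha => hσ.1.mapsTo ha
  obtain ⟨col, hcol⟩ := ih (S \ K) (Finset.sdiff_ssubset hK.1.1 ⟨x, hxyzK (by simp)⟩)
  have hmixed : ∀ a ∈ K, ∀ v ∈ S, v ∉ K → G.Adj a v → col (u (σ a)) ≠ col v := by
    intro a ha v hv hvK hav
    have hs := hσK a ha
    exact hcol _ (by simp [huS _ hs, huK _ hs]) _ (by simp [hv, hvK])
      (hjoin _ hs _ ha (hσne a ha) _ (huS _ hs) (huK _ hs) v hv hvK (hua _ hs) hav)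
  refine ⟨fun v => if v ∈ K then col (u (σ v)) else col v, fun v hv w hw hvw => ?_⟩
  by_cases hvK : v ∈ K <;> by_cases hwK : w ∈ K <;> simp only [hvK, hwK, if_true, if_false]
  · have hs := hσK v hvK
    have ht := hσK w hwK
    exact hcol _ (by simp [huS _ hs, huK _ hs]) _ (by simp [huS _ ht, huK _ ht])
      (hjoin _ hs _ ht (σ.injective.ne hvw.ne) _ (huS _ hs) (huK _ hs) _ (huS _ ht) (huK _ ht)
        (hua _ hs) (hua _ ht))
  · exact hmixed v hvK w hw hwK hvw
  · exact (hmixed w hwK v hv hvK hvw.symm).symm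
  · exact hcol v (by simp [hv, hvK]) w (by simp [hw, hwK]) hvw

theorem statement_14 {V : Type*} [Fintype V] (G : SimpleGraph V)
    (hP : ¬ ContainsInduced P2UnionP4 G)
    (hbull : ¬ ContainsInduced BullGraph G)
    (hdiamond : ¬ ContainsInduced DiamondGraph G) :
    G.chromaticNumber ≤ max 4 (G.cliqueNum : ℕ∞) := by
  obtain ⟨col, hcol⟩ := SimpleGraph.exists_coloring_of_free hP hbull hdiamond
    (le_max_left 4 G.cliqueNum)
    (fun K (hK : G.IsClique K) =>
      (SimpleGraph.IsClique.card_le_cliqueNum (tc := hK)).trans (le_max_right _ _))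
    Finset.univ
  have hcolorable : G.Colorable (max 4 G.cliqueNum) :=
    ⟨SimpleGraph.Coloring.mk col fun {v w} h =>
      hcol v (Finset.mem_univ _) w (Finset.mem_univ _) h⟩
  calc
    G.chromaticNumber ≤ ((max 4 G.cliqueNum : ℕ) : ℕ∞) := hcolorable.chromaticNumber_le
    _ = max 4 (G.cliqueNum : ℕ∞) := rfl
end

section
/- Let G be a (P2∪P4, C3)-free simple graph, let v be a vertex of G, and let C = v1v2v3v4v5v1 be an induced 5-cycle contained in M(v), the set of vertices distinct from v and nonadjacent to v. Then every vertex u adjacent to v satisfies: the set of neighbors of u in C equals {v_i, v_{i+2}} for some i ∈ {1,...,5} (indices modulo 5). -/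
open SimpleGraph

/-- If distinct vertices of `H` have distinct neighbourhoods, then a map that preserves and
reflects adjacency is injective, hence exhibits `H` as an induced subgraph. -/
theorem ContainsInduced.of_twinFree {α β : Type*} {H : SimpleGraph α} {G : SimpleGraph β}
    (hH : ∀ a b, (∀ x, H.Adj a x ↔ H.Adj b x) → a = b) (f : α → β)
    (hf : ∀ a b, G.Adj (f a) (f b) ↔ H.Adj a b) : ContainsInduced H G :=
  ⟨⟨f, fun a b hab => hH a b fun x => by rw [← hf, ← hf, hab]⟩, hf⟩

theorem containsInduced_triangleGraph {V : Type*} {G : SimpleGraph V} {x y z : V}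
    (hxy : G.Adj x y) (hyz : G.Adj y z) (hxz : G.Adj x z) :
    ContainsInduced TriangleGraph G := by
  have hadj : ∀ a b : Fin 3, G.Adj (![x, y, z] a) (![x, y, z] b) ↔
      TriangleGraph.Adj a b := by
    intro a b
    fin_cases a <;> fin_cases b <;>
      simp [TriangleGraph, hxy, hyz, hxz, hxy.symm, hyz.symm, hxz.symm]
  refine .of_twinFree (fun a b hab => ?_) ![x, y, z] hadj
  simpa [TriangleGraph] using hab b

theorem P2UnionP4_eq_of_forall_adj_iff {a b : Fin 6}
    (h : ∀ x, P2UnionP4.Adj a x ↔ P2UnionP4.Adj b x) : a = b := by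
  simp only [P2UnionP4, fromEdgeSet_adj, Set.mem_insert_iff, Set.mem_singleton_iff] at h
  revert h
  decide +revert

/-- An edge `vu` neither of whose ends has a neighbour on four consecutive vertices of an induced 5-cycle
gives an induced `P2 ∪ P4`. -/
theorem containsInduced_P2UnionP4_of_edge_of_cycle {V : Type*} {G : SimpleGraph V}
    {v u : V} {c : Fin 5 → V}
    (hC : ∀ i j, G.Adj (c i) (c j) ↔ (j = i + 1 ∨ i = j + 1)) (hu : G.Adj v u)
    (hv : ∀ i, ¬ G.Adj v (c i)) (k : Fin 5)
    (hk : ∀ j, j ≠ k → ¬ G.Adj u (c j)) :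
    ContainsInduced P2UnionP4 G := by
  obtain ⟨d, hd⟩ : ∃ d : Fin 5 → V, ∀ i, d i = c (i + (k + 1)) := ⟨_, fun _ => rfl⟩
  have hdC : ∀ i j, G.Adj (d i) (d j) ↔ (j = i + 1 ∨ i = j + 1) := fun i j => by
    simp only [hd, hC, add_right_comm _ (k + 1) 1, add_left_inj]
  have hdv : ∀ i, ¬ G.Adj v (d i) := fun i => hd i ▸ hv _
  have hdu : ∀ j, j ≠ 4 → ¬ G.Adj u (d j) := fun j hj => by
    rw [hd]
    refine hk _ fun h => hj ?_
    clear * - h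
    decide +revert
  have hadj : ∀ a b : Fin 6, G.Adj (![v, u, d 0, d 1, d 2, d 3] a)
      (![v, u, d 0, d 1, d 2, d 3] b) ↔ P2UnionP4.Adj a b := by
    intro a b
    fin_cases a <;> fin_cases b <;>
      simp [P2UnionP4, hu, hu.symm, hdv, hdu, hdC, G.adj_comm (d _) v, G.adj_comm (d _) u]
  exact .of_twinFree (fun _ _ => P2UnionP4_eq_of_forall_adj_iff) _ hadj

theorem exists_eq_pair_of_independent_of_not_subsingleton (p : Fin 5 → Prop)
    (hind : ∀ i, p i → ¬ p (i + 1)) (htwo : ∀ k, ∃ j, j ≠ k ∧ p j) :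
    ∃ i, ∀ j, p j ↔ (j = i ∨ j = i + 2) := by
  classical
  have key : ∀ q : Fin 5 → Bool, (∀ i, q i = true → ¬ q (i + 1) = true) →
      (∀ k, ∃ j, j ≠ k ∧ q j = true) → ∃ i, ∀ j, q j = true ↔ (j = i ∨ j = i + 2) := by
    decide
  simpa using key (fun i => decide (p i)) (by simpa using hind) (by simpa using htwo)

theorem statement_15 {V : Type*} [Fintype V] (G : SimpleGraph V)
    (hP : ¬ ContainsInduced P2UnionP4 G)
    (hC3 : ¬ ContainsInduced TriangleGraph G)
    (v : V) (c : Fin 5 → V) (hinj : Function.Injective c)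
    (hM : ∀ i, c i ≠ v ∧ ¬ G.Adj v (c i))
    (hC : ∀ i j, G.Adj (c i) (c j) ↔ (j = i + 1 ∨ i = j + 1))
    (u : V) (hu : G.Adj v u) :
    ∃ i : Fin 5, ∀ j, G.Adj u (c j) ↔ (j = i ∨ j = i + 2) := by
  refine exists_eq_pair_of_independent_of_not_subsingleton _ (fun i hi hi' => ?_) fun k => ?_
  · exact hC3 (containsInduced_triangleGraph hi ((hC _ _).2 (Or.inl rfl)) hi')
  · by_contra! h
    exact hP (containsInduced_P2UnionP4_of_edge_of_cycle hC hu (fun i => (hM i).2) k h)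
end

section
/- Let G be a (P2∪P4, C3)-free simple graph with no comparable pair, let v be a vertex of G, and let C = v1v2v3v4v5v1 be an induced 5-cycle contained in M(v), the set of vertices distinct from v and nonadjacent to v. Then for each i ∈ {1,...,5} (indices modulo 5), at most one vertex of N(v) is adjacent to both v_i and v_{i+2}. -/
open SimpleGraph

/-- Two vertices of `P2 ∪ P4` with the same neighbors are equal. -/
lemma P2UnionP4.eq_of_adj_iff :
    ∀ i j : Fin 6, (∀ k, P2UnionP4.Adj i k ↔ P2UnionP4.Adj j k) → i = j := by
  simp only [P2UnionP4, fromEdgeSet_adj, Set.mem_insert_iff, Set.mem_singleton_iff]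
  decide

/-- An edge `ab` and an induced path `pqrs` with no edges between them form an induced
`P2 ∪ P4`. -/
lemma containsInduced_P2UnionP4 {V : Type*} {G : SimpleGraph V} {a b p q r s : V}
    (hab : G.Adj a b) (hpq : G.Adj p q) (hqr : G.Adj q r) (hrs : G.Adj r s)
    (hpr : ¬ G.Adj p r) (hps : ¬ G.Adj p s) (hqs : ¬ G.Adj q s)
    (hap : ¬ G.Adj a p) (haq : ¬ G.Adj a q) (har : ¬ G.Adj a r) (has : ¬ G.Adj a s)
    (hbp : ¬ G.Adj b p) (hbq : ¬ G.Adj b q) (hbr : ¬ G.Adj b r) (hbs : ¬ G.Adj b s) :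
    ContainsInduced P2UnionP4 G := by
  have key : ∀ i j, G.Adj (![a, b, p, q, r, s] i) (![a, b, p, q, r, s] j) ↔
      P2UnionP4.Adj i j := by
    intro i j
    fin_cases i <;> fin_cases j <;> simp [P2UnionP4, *, G.adj_comm b a, G.adj_comm q p,
      G.adj_comm r q, G.adj_comm s r, G.adj_comm r p, G.adj_comm s p, G.adj_comm s q,
      G.adj_comm p a, G.adj_comm q a, G.adj_comm r a, G.adj_comm s a, G.adj_comm p b,
      G.adj_comm q b, G.adj_comm r b, G.adj_comm s b]
  refine ⟨⟨![a, b, p, q, r, s], fun i j hij => P2UnionP4.eq_of_adj_iff i j fun k => ?_⟩, key⟩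
  rw [← key, ← key, hij]

/-- Three pairwise adjacent vertices form an induced triangle. -/
lemma containsInduced_TriangleGraph {V : Type*} {G : SimpleGraph V} {a b c : V}
    (hab : G.Adj a b) (hbc : G.Adj b c) (hac : G.Adj a c) :
    ContainsInduced TriangleGraph G := by
  have key : ∀ i j, G.Adj (![a, b, c] i) (![a, b, c] j) ↔ TriangleGraph.Adj i j := by
    intro i j
    fin_cases i <;> fin_cases j <;>
      simp [TriangleGraph, *, G.adj_comm b a, G.adj_comm c a, G.adj_comm c b]
  refine ⟨⟨![a, b, c], fun i j hij => ?_⟩, key⟩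
  by_contra hne
  exact G.loopless.irrefl _ (hij ▸ (key i j).2 hne)

/-- In a `(P2 ∪ P4, C3)`-free graph, let `x` and `y` be neighbors of a vertex `v` that is
anticomplete to an induced 5-cycle. If both are adjacent to the same two cycle vertices at
distance two, then every neighbor of `x` is a neighbor of `y`. -/
lemma neighborSet_subset_of_adj_cycle {V : Type*} {G : SimpleGraph V}
    (hP : ¬ ContainsInduced P2UnionP4 G) (hC3 : ¬ ContainsInduced TriangleGraph G)
    {v c₀ c₁ c₂ c₃ c₄ x y : V}
    (h₀₁ : G.Adj c₀ c₁) (h₁₂ : G.Adj c₁ c₂) (h₂₃ : G.Adj c₂ c₃) (h₃₄ : G.Adj c₃ c₄)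
    (h₄₀ : G.Adj c₄ c₀) (hv₀ : ¬ G.Adj v c₀) (hv₁ : ¬ G.Adj v c₁) (hv₂ : ¬ G.Adj v c₂)
    (hv₃ : ¬ G.Adj v c₃) (hv₄ : ¬ G.Adj v c₄) (hvx : G.Adj v x) (hvy : G.Adj v y)
    (hx₀ : G.Adj x c₀) (hx₂ : G.Adj x c₂) (hy₀ : G.Adj y c₀) (hy₂ : G.Adj y c₂) :
    G.neighborSet x ⊆ G.neighborSet y := by
  have tri : ∀ {p q r : V}, G.Adj p q → G.Adj q r → ¬ G.Adj p r :=
    fun hpq hqr hpr => hC3 (containsInduced_TriangleGraph hpq hqr hpr)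
  intro a hxa
  by_contra hya
  rw [mem_neighborSet] at hxa hya
  have hav : ¬ G.Adj a v := tri hxa.symm hvx.symm
  have ha₀ : ¬ G.Adj a c₀ := tri hxa.symm hx₀
  have ha₂ : ¬ G.Adj a c₂ := tri hxa.symm hx₂
  have hay : ¬ G.Adj a y := fun h => hya h.symm
  have hy₁ : ¬ G.Adj y c₁ := tri hy₀ h₀₁
  have hy₃ : ¬ G.Adj y c₃ := tri hy₂ h₂₃
  have hy₄ : ¬ G.Adj y c₄ := tri hy₀ h₄₀.symm
  have hx₃ : ¬ G.Adj x c₃ := tri hx₂ h₂₃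
  have hx₄ : ¬ G.Adj x c₄ := tri hx₀ h₄₀.symm
  have hxy : ¬ G.Adj x y := tri hvx.symm hvy
  have h₁₃ : ¬ G.Adj c₁ c₃ := tri h₁₂ h₂₃
  have h₁₄ : ¬ G.Adj c₁ c₄ := tri h₀₁.symm h₄₀.symm
  have h₀₃ : ¬ G.Adj c₀ c₃ := tri h₄₀.symm h₃₄.symm
  have h₂₄ : ¬ G.Adj c₂ c₄ := tri h₂₃ h₃₄
  have symm : ∀ {p q : V}, ¬ G.Adj p q → ¬ G.Adj q p := fun h h' => h h'.symm
  by_cases ha₃ : G.Adj a c₃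
  · have ha₄ : ¬ G.Adj a c₄ := tri ha₃ h₃₄
    by_cases ha₁ : G.Adj a c₁
    · exact hP (containsInduced_P2UnionP4 hvy ha₁.symm ha₃ h₃₄ h₁₃ h₁₄ ha₄
        hv₁ (symm hav) hv₃ hv₄ hy₁ hya hy₃ hy₄)
    · exact hP (containsInduced_P2UnionP4 ha₃ h₀₁.symm hy₀.symm hvy.symm
        (symm hy₁) (symm hv₁) (symm hv₀) ha₁ ha₀ hay hav
        (symm h₁₃) (symm h₀₃) (symm hy₃) (symm hv₃))
  · by_cases ha₄ : G.Adj a c₄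
    · by_cases ha₁ : G.Adj a c₁
      · exact hP (containsInduced_P2UnionP4 hvy ha₁.symm ha₄ h₃₄.symm h₁₄ h₁₃ ha₃
          hv₁ (symm hav) hv₄ hv₃ hy₁ hya hy₄ hy₃)
      · exact hP (containsInduced_P2UnionP4 ha₄ h₁₂ hy₂.symm hvy.symm
          (symm hy₁) (symm hv₁) (symm hv₂) ha₁ ha₂ hay hav
          (symm h₁₄) (symm h₂₄) (symm hy₄) (symm hv₄))
    · exact hP (containsInduced_P2UnionP4 h₃₄ hxa.symm hvx.symm hvy hav hay hxy
        (symm ha₃) (symm hx₃) (symm hv₃) (symm hy₃)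
        (symm ha₄) (symm hx₄) (symm hv₄) (symm hy₄))

theorem statement_16 {V : Type*} [Fintype V] (G : SimpleGraph V)
    (hP : ¬ ContainsInduced P2UnionP4 G)
    (hC3 : ¬ ContainsInduced TriangleGraph G)
    (hncp : ¬ ∃ u w : V, u ≠ w ∧ ¬ G.Adj u w ∧ G.neighborSet u ⊆ G.neighborSet w)
    (v : V) (c : Fin 5 → V) (hinj : Function.Injective c)
    (hM : ∀ i, c i ≠ v ∧ ¬ G.Adj v (c i))
    (hC : ∀ i j, G.Adj (c i) (c j) ↔ (j = i + 1 ∨ i = j + 1)) :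
    ∀ i : Fin 5, ∀ x y : V, G.Adj v x → G.Adj v y →
      G.Adj x (c i) → G.Adj x (c (i + 2)) → G.Adj y (c i) → G.Adj y (c (i + 2)) →
      x = y := by
  intro i x y hvx hvy hx₀ hx₂ hy₀ hy₂
  have hadj : ∀ j k, k = j + 1 → G.Adj (c j) (c k) := fun j k hk => (hC _ _).2 (Or.inl hk)
  by_contra hne
  refine hncp ⟨x, y, hne, fun hxy => hC3 (containsInduced_TriangleGraph hvx hxy hvy), ?_⟩
  exact neighborSet_subset_of_adj_cycle hP hC3 (c₁ := c (i + 1)) (c₃ := c (i + 3))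
    (c₄ := c (i + 4)) (hadj _ _ (by lia)) (hadj _ _ (by lia)) (hadj _ _ (by lia))
    (hadj _ _ (by lia)) (hadj _ _ (by lia)) (hM _).2 (hM _).2 (hM _).2 (hM _).2 (hM _).2
    hvx hvy hx₀ hx₂ hy₀ hy₂
end

section
/- Let G be a bull-free simple graph, let v be a vertex of G, let v' be a neighbor of v, and let H be an induced complement of a cycle on k ≥ 5 vertices (an antihole) with all vertices of H nonadjacent to v and distinct from v. Then either the set of neighbors of v' in V(H) is a stable set, or v' is adjacent to all vertices of H. -/
open SimpleGraph

/-- In a bull-free graph, for a triangle `x a b` and a vertex `v` whose only neighbor in the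
triangle is `x`, a vertex adjacent to `a` but not to `x` or `v` is adjacent to `b`. -/
theorem adj_of_bullFree {V : Type*} {G : SimpleGraph V} (hbull : ¬ ContainsInduced BullGraph G)
    {v x a b d : V} (hvx : G.Adj v x) (hxa : G.Adj x a) (hxb : G.Adj x b) (hab : G.Adj a b)
    (hva : ¬ G.Adj v a) (hvb : ¬ G.Adj v b) (hvd : ¬ G.Adj v d) (hxd : ¬ G.Adj x d)
    (hda : G.Adj d a) : G.Adj d b := by
  by_contra hdb
  have hadj : ∀ i j : Fin 5,
      G.Adj (![x, a, b, v, d] i) (![x, a, b, v, d] j) ↔ BullGraph.Adj i j := by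
    intro i j
    fin_cases i <;> fin_cases j <;>
      simp [BullGraph, hvx, hvx.symm, hxa, hxa.symm, hxb, hxb.symm, hab, hab.symm, hva, hvb, hvd,
        hxd, hda, hda.symm, hdb, G.adj_comm a v, G.adj_comm b v, G.adj_comm d v, G.adj_comm d x,
        G.adj_comm b d]
  have hinj : Function.Injective ![x, a, b, v, d] := by
    intro i j hij
    have h : ∀ l, BullGraph.Adj i l ↔ BullGraph.Adj j l := fun l => by
      rw [← hadj, ← hadj, hij]
    revert h
    fin_cases i <;> fin_cases j <;> simp [BullGraph, Fin.forall_fin_succ]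
  exact hbull ⟨⟨_, hinj⟩, hadj⟩

/-- A predicate on `ZMod k` that holds somewhere and is stable under predecessors holds
everywhere. -/
theorem ZMod.forall_of_add_one_imp {k : ℕ} [NeZero k] {P : ZMod k → Prop} {a : ZMod k} (ha : P a)
    (h : ∀ m, P (m + 1) → P m) (b : ZMod k) : P b := by
  have key : ∀ n : ℕ, P (a - n) := by
    intro n
    induction n with
    | zero => simpa using ha
    | succ n ih =>
      apply h
      convert ih using 1
      push_cast
      ring
  simpa using key (a - b).val

theorem statement_17 {V : Type*} [Fintype V] (G : SimpleGraph V)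
    (hbull : ¬ ContainsInduced BullGraph G)
    (v v' : V) (hv' : G.Adj v v')
    (k : ℕ) (hk : 5 ≤ k) (c : ZMod k → V) (hinj : Function.Injective c)
    (hM : ∀ i, c i ≠ v ∧ ¬ G.Adj v (c i))
    (hH : ∀ i j, G.Adj (c i) (c j) ↔ (i ≠ j ∧ ¬ (j = i + 1 ∨ i = j + 1))) :
    (∀ i j, G.Adj v' (c i) → G.Adj v' (c j) → ¬ G.Adj (c i) (c j)) ∨
    (∀ i, G.Adj v' (c i)) := by
  by_contra! hcon
  obtain ⟨⟨i, j, hi, hj, hij⟩, b, hb⟩ := hcon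
  have : NeZero k := ⟨by omega⟩
  have hne : ∀ n : ℕ, 0 < n → n < 5 → (n : ZMod k) ≠ 0 := fun n h0 h5 h =>
    absurd (Nat.le_of_dvd h0 ((ZMod.natCast_eq_zero_iff n k).1 h)) (by omega)
  have h1 : (1 : ZMod k) ≠ 0 := mod_cast hne 1 (by norm_num) (by norm_num)
  have h2 : (2 : ZMod k) ≠ 0 := mod_cast hne 2 (by norm_num) (by norm_num)
  have h3 : (3 : ZMod k) ≠ 0 := mod_cast hne 3 (by norm_num) (by norm_num)
  have h4 : (4 : ZMod k) ≠ 0 := mod_cast hne 4 (by norm_num) (by norm_num)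
  have key : ∀ a b d, G.Adj v' (c a) → G.Adj v' (c b) → G.Adj (c a) (c b) →
      ¬ G.Adj v' (c d) → G.Adj (c d) (c a) → G.Adj (c d) (c b) :=
    fun a b d ha hb hab hd hda => adj_of_bullFree hbull hv' ha hb hab (hM a).2 (hM b).2 (hM d).2
      hd hda
  obtain ⟨m, hm1, hm⟩ : ∃ m, G.Adj v' (c (m + 1)) ∧ ¬ G.Adj v' (c m) := by
    by_contra! h
    exact hb (ZMod.forall_of_add_one_imp (P := fun i => G.Adj v' (c i)) hi h b)
  simp only [hH] at key hij
  clear hH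
  have hsub : ∀ x, G.Adj v' (c x) → x = m + 1 ∨ x = m + 2 ∨ x = m - 1 := by
    intro x hx
    have hxm : x ≠ m := fun h => hm (h ▸ hx)
    have := key x (m + 1) m hx hm1
    clear key hM hne hb
    grind +splitImp
  have hpred : G.Adj v' (c (m - 1)) := by
    have := hsub i hi
    have := hsub j hj
    clear key hM hne hb
    grind +splitImp
  by_cases hm2 : G.Adj v' (c (m + 2))
  · have := key (m + 2) (m - 1) m hm2 hpred
      ⟨fun h => h3 (by linear_combination h), not_or.2
        ⟨fun h => h4 (by linear_combination -h), fun h => h2 (by linear_combination h)⟩⟩ hm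
      ⟨fun h => h2 (by linear_combination -h), not_or.2
        ⟨fun h => h1 (by linear_combination h), fun h => h3 (by linear_combination -h)⟩⟩
    exact this.2 (Or.inr (by ring))
  · have := key (m - 1) (m + 1) (m + 2) hpred hm1
      ⟨fun h => h2 (by linear_combination -h), not_or.2
        ⟨fun h => h1 (by linear_combination h), fun h => h3 (by linear_combination -h)⟩⟩ hm2
      ⟨fun h => h3 (by linear_combination h), not_or.2
        ⟨fun h => h4 (by linear_combination -h), fun h => h2 (by linear_combination h)⟩⟩
    exact this.2 (Or.inr (by ring))
end

section
/- Let G be a bull-free simple graph, let v be a vertex of G, and let C = v1v2v3v4v5v1 be an induced 5-cycle contained in M(v), the set of vertices distinct from v and nonadjacent to v. Suppose u and u' are adjacent vertices in N(v) such that the neighborhood of u in C equals {v_i, v_{i+2}} and the neighborhood of u' in C equals {v_j, v_{j+2}} for some i, j ∈ {1,...,5} (indices modulo 5). Then u and u' have the same neighborhood in C. -/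
open SimpleGraph

/-- Adjacencies and non-adjacencies witnessing a bull with triangle `a b x` and pendant edges
`a d`, `b e` yield an induced bull. -/
lemma containsInduced_bull {V : Type*} {G : SimpleGraph V} {a b x d e : V}
    (hab : G.Adj a b) (hax : G.Adj a x) (hbx : G.Adj b x) (had : G.Adj a d) (hbe : G.Adj b e)
    (hae : ¬ G.Adj a e) (hbd : ¬ G.Adj b d) (hxd : ¬ G.Adj x d) (hxe : ¬ G.Adj x e)
    (hde : ¬ G.Adj d e) : ContainsInduced BullGraph G := by
  have hadj : ∀ m n : Fin 5, G.Adj (![a, b, x, d, e] m) (![a, b, x, d, e] n) ↔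
      BullGraph.Adj m n := by
    intro m n
    fin_cases m <;> fin_cases n <;>
      simp [BullGraph, hab, hax, hbx, had, hbe, hae, hbd, hxd, hxe, hde, G.adj_comm b a,
        G.adj_comm x a, G.adj_comm x b, G.adj_comm d, G.adj_comm e]
  refine ⟨⟨![a, b, x, d, e], fun m n hmn => ?_⟩, hadj⟩
  have htwin : ∀ k, BullGraph.Adj m k ↔ BullGraph.Adj n k := fun k => by
    rw [← hadj, ← hadj, hmn]
  have h0 := htwin 0
  have h1 := htwin 1
  have h2 := htwin 2
  have h3 := htwin 3
  have h4 := htwin 4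
  clear htwin hmn
  fin_cases m <;> fin_cases n <;> simp [BullGraph] at h0 h1 h2 h3 h4 ⊢

/-- In a bull-free graph, the neighborhoods `{i, i + 2}` and `{j, j + 2}` in a 5-cycle of two
adjacent vertices with a common neighbor anticomplete to the cycle are not shifted by one or
two. -/
lemma not_shift_of_bullFree {V : Type*} {G : SimpleGraph V}
    (hbull : ¬ ContainsInduced BullGraph G) {v : V} {c : Fin 5 → V}
    (hM : ∀ i, ¬ G.Adj v (c i))
    (hC : ∀ i j, G.Adj (c i) (c j) ↔ (j = i + 1 ∨ i = j + 1))
    {u u' : V} (huv : G.Adj v u) (hu'v : G.Adj v u') (huu' : G.Adj u u') {i j : Fin 5}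
    (hu : ∀ m, G.Adj u (c m) ↔ (m = i ∨ m = i + 2))
    (hu' : ∀ m, G.Adj u' (c m) ↔ (m = j ∨ m = j + 2)) :
    j ≠ i + 1 ∧ j ≠ i + 2 := by
  refine ⟨?_, ?_⟩ <;> rintro rfl <;> apply hbull
  · apply containsInduced_bull (a := u) (b := u') (x := v) (d := c i) (e := c (i + 3))
      huu' huv.symm hu'v.symm <;> simp only [hu, hu', hC, hM, not_false_eq_true] <;>
      clear * - <;> revert i <;> decide
  · apply containsInduced_bull (a := u) (b := c (i + 2)) (x := u') (d := c i) (e := c (i + 3))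
      _ huu' <;> simp only [hu, hu', hC, G.adj_comm (c (i + 2)) u'] <;>
      clear * - <;> revert i <;> decide

theorem statement_19 {V : Type*} [Fintype V] (G : SimpleGraph V)
    (hbull : ¬ ContainsInduced BullGraph G)
    (v : V) (c : Fin 5 → V) (hinj : Function.Injective c)
    (hM : ∀ i, c i ≠ v ∧ ¬ G.Adj v (c i))
    (hC : ∀ i j, G.Adj (c i) (c j) ↔ (j = i + 1 ∨ i = j + 1))
    (u u' : V) (huv : G.Adj v u) (hu'v : G.Adj v u') (huu' : G.Adj u u')
    (i j : Fin 5)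
    (hu : ∀ m, G.Adj u (c m) ↔ (m = i ∨ m = i + 2))
    (hu' : ∀ m, G.Adj u' (c m) ↔ (m = j ∨ m = j + 2)) :
    ∀ m, G.Adj u (c m) ↔ G.Adj u' (c m) := by
  have h := not_shift_of_bullFree hbull (fun k => (hM k).2) hC huv hu'v huu' hu hu'
  have h' := not_shift_of_bullFree hbull (fun k => (hM k).2) hC hu'v huv huu'.symm hu' hu
  have hij : i = j := by
    clear * - h h'
    revert i j
    decide
  subst hij
  intro m
  rw [hu, hu']
end
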